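/- arXiv:1109.1617 — 3 statements merged into one kernel-verified Lean document; each statement's English description precedes it below -/
import Mathlib

section
/- Let ψ : ℝ → ℝ be a real-valued Schwartz function whose Fourier transform ψ̂(ξ) = ∫_ℝ e^{−iξx} ψ(x) dx vanishes outside { ξ : 2π/3 ≤ |ξ| ≤ 8π/3 }, and let Ψ(y,θ) = ∫_ℝ (y−x)₊^{θ−1/2} ψ(x) dx. Let (ε_{j,k})_{(j,k)∈ℤ²} be real numbers for which there is a constant C₀ < ∞ with |ε_{j,k}| ≤ C₀ √( log(2+|j|) log(2+|k|) ) for all (j,k) ∈ ℤ². Then for every (t,θ) ∈ ℝ × (0,1), the double series Σ_{(j,k)∈ℤ²} 2^{−jθ} |ε_{j,k}| · |Ψ(2^j t − k, θ) − Ψ(−k, θ)| converges (is finite); consequently Σ_{(j,k)} 2^{−jθ} ε_{j,k} [Ψ(2^j t − k, θ) − Ψ(−k, θ)] converges to a finite limit independent of the ordering of the terms. -/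
open MeasureTheory Set Real

noncomputable section

/-- `u₊^a`: equals `u^a` if `u > 0` and `0` otherwise. -/
def posRPow (u a : ℝ) : ℝ := if 0 < u then u ^ a else 0

/-- The Fourier transform `ψ̂(ξ) = ∫ e^{−iξx} ψ(x) dx` of a real-valued function. -/
def fourierT (ψ : ℝ → ℝ) (ξ : ℝ) : ℂ :=
  ∫ x : ℝ, Complex.exp (-(Complex.I * ξ * x)) * (ψ x : ℂ)

/-- The fractional primitive `Ψ(y,θ) = ∫ (y−x)₊^{θ−1/2} ψ(x) dx`. -/
def PsiFrac (ψ : ℝ → ℝ) (y θ : ℝ) : ℝ :=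
  ∫ x : ℝ, posRPow (y - x) (θ - 1/2) * ψ x

/-- the singular part of the kernel near the origin -/
def singK (u : ℝ) : ℝ := (Ioc (0:ℝ) 1).indicator (fun u => u ^ (-(1/2) : ℝ)) u

/-- decay weight -/
def decW (y : ℝ) : ℝ := (1 + |y|) ^ (-(3/2) : ℝ)

lemma singK_nonneg (u : ℝ) : 0 ≤ singK u := by
  unfold singK
  apply indicator_nonneg
  intro x hx
  exact Real.rpow_nonneg hx.1.le _

lemma decW_pos (y : ℝ) : 0 < decW y := by
  unfold decW; positivity

lemma posRPow_nonneg (u a : ℝ) : 0 ≤ posRPow u a := by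
  unfold posRPow
  split_ifs with h
  · positivity
  · exact le_rfl

lemma posRPow_le (u a : ℝ) (h1 : -(1/2) < a) (h2 : a < 1/2) :
    posRPow u a ≤ singK u + 1 + |u| := by
  have hs := singK_nonneg u
  have ha := abs_nonneg u
  unfold posRPow
  split_ifs with h
  · rcases le_or_gt u 1 with h3 | h3
    · have : singK u = u ^ (-(1/2) : ℝ) := by
        unfold singK; rw [indicator_of_mem]; exact ⟨h, h3⟩
      have h4 : u ^ a ≤ u ^ (-(1/2) : ℝ) := Real.rpow_le_rpow_of_exponent_ge h h3 h1.le
      linarith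
    · have h4 : u ^ a ≤ u ^ (1 : ℝ) := Real.rpow_le_rpow_of_exponent_le h3.le (by linarith)
      rw [Real.rpow_one] at h4
      have := le_abs_self u
      linarith
  · linarith

lemma taylor_aux (a s : ℝ) (h1 : -(1/2) < a) (h2 : a < 1/2) (hs : |s| ≤ 1/2) :
    |(1 - s) ^ a - 1 + a * s| ≤ 2 * s ^ 2 := by
  obtain ⟨hs1, hs2⟩ := abs_le.mp hs
  have hp : 0 < 1 - s := by linarith
  have sq := sq_nonneg s
  rcases le_or_gt 0 a with h | h
  · have b1 : (1 - s) ^ a ≤ 1 - a * s := by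
      have := rpow_one_add_le_one_add_mul_self (s := -s) (by linarith) h (by linarith)
      rw [← sub_eq_add_neg] at this
      linarith
    have b2 : (1 - s) ^ (1 - a) ≤ 1 - (1 - a) * s := by
      have := rpow_one_add_le_one_add_mul_self (s := -s) (p := 1 - a) (by linarith)
        (by linarith) (by linarith)
      rw [← sub_eq_add_neg] at this
      linarith
    have b3 : (1 - s) ^ a * (1 - s) ^ (1 - a) = 1 - s := by
      rw [← Real.rpow_add hp]; simp
    have hpa : 0 < (1 - s) ^ a := Real.rpow_pos_of_pos hp _
    have b4 : 1 - s ≤ (1 - s) ^ a * (1 - (1 - a) * s) := by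
      calc 1 - s = (1 - s) ^ a * (1 - s) ^ (1 - a) := b3.symm
        _ ≤ _ := by gcongr
    have hq : 1 / 2 ≤ 1 - (1 - a) * s := by nlinarith
    rw [abs_le]
    constructor
    · by_contra hcon
      push Not at hcon
      have : (1 - s) ^ a < 1 - a * s - 2 * s ^ 2 := by linarith
      have h5 : (1 - s) ^ a * (1 - (1 - a) * s) < (1 - a * s - 2 * s ^ 2) * (1 - (1 - a) * s) := by
        apply mul_lt_mul_of_pos_right this (by linarith)
      have : (1 - a * s - 2 * s ^ 2) * (1 - (1 - a) * s) - (1 - s)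
        = s ^ 2 * (a * (1 - a) - 2 * (1 - (1 - a) * s)) := by ring
      have : s ^ 2 * (a * (1 - a) - 2 * (1 - (1 - a) * s)) ≤ 0 := by
        apply mul_nonpos_of_nonneg_of_nonpos sq
        nlinarith
      linarith
    · linarith
  · have b1 : (1 - s) ^ (-a) ≤ 1 + a * s := by
      have := rpow_one_add_le_one_add_mul_self (s := -s) (p := -a) (by linarith) (by linarith)
        (by linarith)
      rw [← sub_eq_add_neg] at this
      linarith
    have b2 : (1 - s) ^ (1 + a) ≤ 1 - (1 + a) * s := by
      have := rpow_one_add_le_one_add_mul_self (s := -s) (p := 1 + a) (by linarith)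
        (by linarith) (by linarith)
      rw [← sub_eq_add_neg] at this
      linarith
    have b3 : (1 - s) ^ (1 + a) = (1 - s) * (1 - s) ^ a := by
      rw [Real.rpow_add hp, Real.rpow_one]
    have b5 : (1 - s) ^ a * (1 - s) ^ (-a) = 1 := by
      rw [← Real.rpow_add hp]; simp
    have hpa : 0 < (1 - s) ^ a := Real.rpow_pos_of_pos hp _
    have b6 : 1 ≤ (1 - s) ^ a * (1 + a * s) := by
      calc 1 = (1 - s) ^ a * (1 - s) ^ (-a) := b5.symm
        _ ≤ _ := by gcongr
    rw [b3] at b2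
    have hq : 1 / 2 ≤ 1 + a * s := by nlinarith
    rw [abs_le]
    constructor
    · by_contra hcon
      push Not at hcon
      have : (1 - s) ^ a < 1 - a * s - 2 * s ^ 2 := by linarith
      have h5 : (1 - s) ^ a * (1 + a * s) < (1 - a * s - 2 * s ^ 2) * (1 + a * s) := by
        apply mul_lt_mul_of_pos_right this (by linarith)
      have : (1 - a * s - 2 * s ^ 2) * (1 + a * s) - 1
        = s ^ 2 * (- a ^ 2 - 2 * (1 + a * s)) := by ring
      have : s ^ 2 * (- a ^ 2 - 2 * (1 + a * s)) ≤ 0 := by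
        apply mul_nonpos_of_nonneg_of_nonpos sq
        nlinarith
      linarith
    · by_contra hcon
      push Not at hcon
      have : 1 - a * s + 2 * s ^ 2 < (1 - s) ^ a := by linarith
      have h5 : (1 - s) * (1 - a * s + 2 * s ^ 2) < (1 - s) * (1 - s) ^ a := by
        apply mul_lt_mul_of_pos_left this hp
      have : (1 - s) * (1 - a * s + 2 * s ^ 2) - (1 - (1 + a) * s)
        = s ^ 2 * (a + 2 * (1 - s)) := by ring
      have : 0 ≤ s ^ 2 * (a + 2 * (1 - s)) := by
        apply mul_nonneg sq
        linarith
      linarith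

lemma kernel_approx (a : ℝ) (h1 : -(1/2) < a) (h2 : a < 1/2) (y : ℝ) :
    ∃ α β : ℝ, ∀ x : ℝ, |posRPow (y - x) a - (α + β * x)| ≤
      68 * decW y * ((1 + x ^ 2) ^ 2 * (1 + singK (y - x))) := by
  rcases le_or_gt y 1 with hy | hy
  · refine ⟨0, 0, fun x => ?_⟩
    have hw := decW_pos y
    have hk := singK_nonneg (y - x)
    have hg := posRPow_nonneg (y - x) a
    have hle := posRPow_le (y - x) a h1 h2
    simp only [zero_mul, add_zero, sub_zero]
    rw [abs_of_nonneg hg]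
    rcases le_or_gt y x with hx | hx
    · have : posRPow (y - x) a = 0 := by
        unfold posRPow; rw [if_neg]; linarith
      rw [this]; positivity
    · rw [abs_of_pos (by linarith : 0 < y - x)] at hle
      have hyx : 1 + |y| ≤ 2 + |x| := by
        rcases le_or_gt 0 y with h | h
        · rw [abs_of_nonneg h]; have := abs_nonneg x; linarith
        · rw [abs_of_neg h, abs_of_neg (by linarith)]; linarith
      have hax := abs_nonneg x
      have hsx := sq_abs x
      have hax2 := neg_abs_le x
      have e1 : (1 + |y|) ^ (3/2 : ℝ) ≤ 8 * (1 + x ^ 2) := by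
        calc (1 + |y|) ^ (3/2 : ℝ) ≤ (1 + |y|) ^ (2 : ℝ) :=
              Real.rpow_le_rpow_of_exponent_le (by linarith [abs_nonneg y]) (by norm_num)
          _ = (1 + |y|) ^ 2 := by norm_cast
          _ ≤ (2 + |x|) ^ 2 := by gcongr
          _ ≤ _ := by nlinarith [sq_nonneg (|x| - 2)]
      have e2 : decW y * (1 + |y|) ^ (3/2 : ℝ) = 1 := by
        unfold decW
        rw [← Real.rpow_add (by positivity)]; norm_num
      have e3 : 1 ≤ decW y * (8 * (1 + x ^ 2)) := by
        exact e2.symm.le.trans (by gcongr)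
      have e4 : posRPow (y - x) a ≤ 3 * (1 + x ^ 2) * (1 + singK (y - x)) := by
        nlinarith [mul_nonneg hk (sq_nonneg x), sq_nonneg (|x| - 1)]
      have e5 : 0 ≤ 3 * (1 + x ^ 2) * (1 + singK (y - x)) := by positivity
      calc posRPow (y - x) a ≤ 1 * (3 * (1 + x ^ 2) * (1 + singK (y - x))) := by linarith
        _ ≤ (decW y * (8 * (1 + x ^ 2))) * (3 * (1 + x ^ 2) * (1 + singK (y - x))) := by gcongr
        _ = 24 * decW y * ((1 + x ^ 2) ^ 2 * (1 + singK (y - x))) := by ring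
        _ ≤ _ := by gcongr; norm_num
  · have y0 : 0 < y := by linarith
    set R : ℝ := y ^ (-(3/2) : ℝ) with hR
    have R0 : 0 < R := Real.rpow_pos_of_pos y0 _
    have hy1 : y ^ a ≤ y ^ 2 * R := by
      rw [hR, ← Real.rpow_natCast y 2, ← Real.rpow_add y0]
      apply Real.rpow_le_rpow_of_exponent_le hy.le
      norm_num; linarith
    have hy2 : 1 ≤ y ^ 2 * R := by
      rw [hR, ← Real.rpow_natCast y 2, ← Real.rpow_add y0]
      apply Real.one_le_rpow hy.le
      norm_num
    have hya : 0 < y ^ a := Real.rpow_pos_of_pos y0 _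
    have hRw : R ≤ 4 * decW y := by
      unfold decW
      rw [abs_of_pos y0]
      have : (2 * y) ^ (-(3/2) : ℝ) ≤ (1 + y) ^ (-(3/2) : ℝ) :=
        Real.rpow_le_rpow_of_nonpos (by linarith) (by linarith) (by norm_num)
      rw [Real.mul_rpow (by norm_num) y0.le] at this
      have h4 : (4:ℝ)⁻¹ ≤ (2:ℝ) ^ (-(3/2) : ℝ) := by
        calc (4:ℝ)⁻¹ = (2:ℝ) ^ (-2 : ℝ) := by
              rw [Real.rpow_neg (by norm_num)]; norm_num
          _ ≤ _ := Real.rpow_le_rpow_of_exponent_le (by norm_num) (by norm_num)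
      have : (4:ℝ)⁻¹ * R ≤ (1 + y) ^ (-(3/2) : ℝ) :=
        le_trans (by gcongr) this
      linarith
    refine ⟨y ^ a, -(a * y ^ a / y), fun x => ?_⟩
    have hk := singK_nonneg (y - x)
    have hg := posRPow_nonneg (y - x) a
    have hle := posRPow_le (y - x) a h1 h2
    have hax := abs_nonneg x
    have hsx := sq_abs x
    suffices hh : |posRPow (y - x) a - (y ^ a + -(a * y ^ a / y) * x)| ≤
        17 * R * ((1 + x ^ 2) ^ 2 * (1 + singK (y - x))) by
      refine hh.trans ?_
      calc _ ≤ 17 * (4 * decW y) * ((1 + x ^ 2) ^ 2 * (1 + singK (y - x))) := by gcongr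
        _ = _ := by ring
    have m1 : x ^ 2 ≤ (1 + x ^ 2) ^ 2 * (1 + singK (y - x)) := by
      have : 1 + x ^ 2 ≤ (1 + x ^ 2) ^ 2 := by nlinarith [sq_nonneg x]
      nlinarith [mul_nonneg (sq_nonneg (1 + x ^ 2)) hk]
    rcases le_or_gt |x| (y / 2) with hx | hx
    · have hxx := abs_le.mp hx
      have hs : |x / y| ≤ 1 / 2 := by
        rw [abs_div, abs_of_pos y0, div_le_iff₀ y0]; linarith
      have ht := taylor_aux a (x / y) h1 h2 hs
      have hgg : posRPow (y - x) a = y ^ a * (1 - x / y) ^ a := by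
        unfold posRPow
        rw [if_pos (by linarith), ← Real.mul_rpow y0.le]
        · congr 1; field_simp
        · have := (abs_le.mp hs).2; linarith
      have : posRPow (y - x) a - (y ^ a + -(a * y ^ a / y) * x)
          = y ^ a * ((1 - x / y) ^ a - 1 + a * (x / y)) := by
        rw [hgg]; ring
      rw [this, abs_mul, abs_of_pos hya]
      calc y ^ a * |(1 - x / y) ^ a - 1 + a * (x / y)| ≤ (y ^ 2 * R) * (2 * (x / y) ^ 2) := by gcongr
        _ = 2 * R * x ^ 2 := by field_simp
        _ ≤ 17 * R * ((1 + x ^ 2) ^ 2 * (1 + singK (y - x))) := by gcongr; norm_num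
    · have hyx : y ^ 2 ≤ 4 * x ^ 2 := by nlinarith
      have c1 : y ^ a ≤ 4 * x ^ 2 * R := hy1.trans (by gcongr)
      have c2 : |-(a * y ^ a / y) * x| ≤ x ^ 2 * R := by
        have ha : |a| ≤ 1 / 2 := abs_le.mpr ⟨h1.le, h2.le⟩
        rw [abs_mul, abs_neg, abs_div, abs_mul, abs_of_pos hya, abs_of_pos y0]
        calc |a| * y ^ a / y * |x| ≤ (1/2) * (y ^ 2 * R) / y * |x| := by gcongr
          _ = (y / 2) * |x| * R := by field_simp
          _ ≤ |x| * |x| * R := by gcongr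
          _ = x ^ 2 * R := by rw [← hsx]; ring
      have c3 : posRPow (y - x) a ≤ (4 * x ^ 2 * R) * (3 * (1 + x ^ 2) * (1 + singK (y - x))) := by
        have : |y - x| ≤ 3 * |x| := by
          calc |y - x| ≤ |y| + |x| := abs_sub y x
            _ ≤ _ := by rw [abs_of_pos y0]; linarith
        have d1 : posRPow (y - x) a ≤ 3 * (1 + x ^ 2) * (1 + singK (y - x)) := by
          nlinarith [mul_nonneg hk (sq_nonneg x), sq_nonneg (|x| - 1)]
        have d2 : 1 ≤ 4 * x ^ 2 * R := hy2.trans (by gcongr)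
        have d3 : 0 ≤ 3 * (1 + x ^ 2) * (1 + singK (y - x)) := by positivity
        calc _ ≤ 1 * (3 * (1 + x ^ 2) * (1 + singK (y - x))) := by linarith
          _ ≤ _ := by gcongr
      have c4 : (4 * x ^ 2 * R) * (3 * (1 + x ^ 2) * (1 + singK (y - x)))
          ≤ 12 * R * ((1 + x ^ 2) ^ 2 * (1 + singK (y - x))) := by
        have : x ^ 2 * (1 + x ^ 2) ≤ (1 + x ^ 2) ^ 2 := by nlinarith [sq_nonneg x]
        calc _ = 12 * R * ((x ^ 2 * (1 + x ^ 2)) * (1 + singK (y - x))) := by ring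
          _ ≤ _ := by gcongr
      have c5 : R * x ^ 2 ≤ R * ((1 + x ^ 2) ^ 2 * (1 + singK (y - x))) := by gcongr
      calc _ ≤ |posRPow (y - x) a| + (|y ^ a| + |-(a * y ^ a / y) * x|) :=
            (abs_sub _ _).trans (by gcongr; exact abs_add_le _ _)
        _ ≤ _ := by
          rw [abs_of_nonneg hg, abs_of_pos hya]
          nlinarith

lemma singK_integrable : Integrable singK := by
  unfold singK
  rw [integrable_indicator_iff measurableSet_Ioc]
  exact (intervalIntegrable_iff_integrableOn_Ioc_of_le (by norm_num)).mp
    (intervalIntegral.intervalIntegrable_rpow' (by norm_num))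

lemma measurable_posRPow (a : ℝ) : Measurable (fun u => posRPow u a) := by
  unfold posRPow
  exact Measurable.ite measurableSet_Ioi (by fun_prop) measurable_const

lemma integrable_of_decay (f : ℝ → ℝ) (M : ℝ) (hf : Continuous f)
    (hb : ∀ x, |f x| ≤ M * ((1 + x ^ 2) ^ 3)⁻¹) :
    Integrable f ∧ Integrable (fun x => x * f x) := by
  have key : ∀ x : ℝ, (1 + x ^ 2) ^ 2 * |f x| ≤ M * (1 + x ^ 2)⁻¹ := by
    intro x
    calc (1 + x ^ 2) ^ 2 * |f x| ≤ (1 + x ^ 2) ^ 2 * (M * ((1 + x ^ 2) ^ 3)⁻¹) := by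
          gcongr; exact hb x
      _ = _ := by field_simp
  constructor
  · refine (integrable_inv_one_add_sq.const_mul M).mono' hf.aestronglyMeasurable
      (Filter.Eventually.of_forall fun x => le_trans ?_ (key x))
    rw [Real.norm_eq_abs]
    apply le_mul_of_one_le_left (abs_nonneg _)
    nlinarith [sq_nonneg x]
  · refine (integrable_inv_one_add_sq.const_mul M).mono'
      (continuous_id.mul hf).aestronglyMeasurable
      (Filter.Eventually.of_forall fun x => le_trans ?_ (key x))
    rw [Real.norm_eq_abs, abs_mul]
    gcongr
    have := sq_abs x
    have := abs_nonneg x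
    nlinarith [sq_nonneg (|x| - 1), sq_nonneg x]

lemma frac_bound (a : ℝ) (h1 : -(1/2) < a) (h2 : a < 1/2) :
    ∃ K : ℝ, 0 ≤ K ∧ ∀ (f : ℝ → ℝ) (M : ℝ), Continuous f → 0 ≤ M →
      (∀ x, |f x| ≤ M * ((1 + x ^ 2) ^ 3)⁻¹) → ∫ x, f x = 0 → ∫ x, x * f x = 0 →
      ∀ y, Integrable (fun x => posRPow (y - x) a * f x) ∧
        |∫ x, posRPow (y - x) a * f x| ≤ K * M * decW y := by
  have hS : 0 ≤ ∫ u, singK u := integral_nonneg singK_nonneg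
  have hI : 0 ≤ ∫ x : ℝ, (1 + x ^ 2)⁻¹ := integral_nonneg (fun x => by positivity)
  refine ⟨68 * ((∫ x : ℝ, (1 + x ^ 2)⁻¹) + ∫ u, singK u), by positivity, ?_⟩
  intro f M hf hM hb hm0 hm1 y
  obtain ⟨i0, i1⟩ := integrable_of_decay f M hf hb
  obtain ⟨α, β, hαβ⟩ := kernel_approx a h1 h2 y
  have hw := decW_pos y
  have hL : Integrable (fun x => (α + β * x) * f x) := by
    refine ((i0.const_mul α).add (i1.const_mul β)).congr (Filter.Eventually.of_forall fun x => ?_)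
    simp only [Pi.add_apply]; ring
  have hLz : ∫ x, (α + β * x) * f x = 0 := by
    have : (fun x => (α + β * x) * f x) = fun x => α * f x + β * (x * f x) := by
      ext x; ring
    rw [this, integral_add (i0.const_mul α) (i1.const_mul β), integral_const_mul,
      integral_const_mul, hm0, hm1]
    simp
  have hsk : Integrable (fun x => singK (y - x)) := singK_integrable.comp_sub_left y
  have hB : Integrable (fun x : ℝ => 68 * decW y * M * ((1 + x ^ 2)⁻¹ + singK (y - x))) :=
    (integrable_inv_one_add_sq.add hsk).const_mul _
  have hbd : ∀ x, ‖(posRPow (y - x) a - (α + β * x)) * f x‖ ≤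
      68 * decW y * M * ((1 + x ^ 2)⁻¹ + singK (y - x)) := by
    intro x
    have hk := singK_nonneg (y - x)
    rw [Real.norm_eq_abs, abs_mul]
    calc _ ≤ (68 * decW y * ((1 + x ^ 2) ^ 2 * (1 + singK (y - x)))) *
          (M * ((1 + x ^ 2) ^ 3)⁻¹) := by
          gcongr
          · exact hαβ x
          · exact hb x
      _ = 68 * decW y * M * ((1 + x ^ 2)⁻¹ + (1 + x ^ 2)⁻¹ * singK (y - x)) := by field_simp
      _ ≤ _ := by
        gcongr
        apply mul_le_of_le_one_left hk
        apply inv_le_one_of_one_le₀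
        nlinarith [sq_nonneg x]
  have hmeas : AEStronglyMeasurable (fun x => (posRPow (y - x) a - (α + β * x)) * f x) := by
    apply AEStronglyMeasurable.mul _ hf.aestronglyMeasurable
    apply Measurable.aestronglyMeasurable
    apply Measurable.sub
    · exact (measurable_posRPow a).comp (measurable_const.sub measurable_id)
    · fun_prop
  have hD : Integrable (fun x => (posRPow (y - x) a - (α + β * x)) * f x) :=
    hB.mono' hmeas (Filter.Eventually.of_forall hbd)
  have heq : (fun x => posRPow (y - x) a * f x) =
      fun x => (posRPow (y - x) a - (α + β * x)) * f x + (α + β * x) * f x := by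
    ext x; ring
  constructor
  · rw [heq]; exact hD.add hL
  · rw [heq, integral_add hD hL, hLz, add_zero]
    calc _ ≤ ∫ x, 68 * decW y * M * ((1 + x ^ 2)⁻¹ + singK (y - x)) :=
          norm_integral_le_of_norm_le hB (Filter.Eventually.of_forall hbd)
      _ = _ := by
        rw [integral_const_mul, integral_add integrable_inv_one_add_sq hsk,
          integral_sub_left_eq_self singK volume y]
        ring

lemma schwartz_decay (ψ : SchwartzMap ℝ ℝ) : ∃ M : ℝ, 0 ≤ M ∧
    (∀ x, |ψ x| ≤ M * ((1 + x ^ 2) ^ 3)⁻¹) ∧ (∀ x, |deriv ψ x| ≤ M * ((1 + x ^ 2) ^ 3)⁻¹) := by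
  have hN : ∀ n : ℕ, n ≤ 1 → ∃ C : ℝ, ∀ x, ‖iteratedFDeriv ℝ n ψ x‖ ≤ C * ((1 + x ^ 2) ^ 3)⁻¹ := by
    intro n hn
    refine ⟨2 ^ 6 * (Finset.Iic ((6, 1) : ℕ × ℕ)).sup
      (fun m => SchwartzMap.seminorm ℝ m.1 m.2) ψ, fun x => ?_⟩
    have := SchwartzMap.one_add_le_sup_seminorm_apply (𝕜 := ℝ) (m := (6, 1)) (k := 6) (n := n)
      le_rfl hn ψ x
    rw [← div_eq_mul_inv, le_div_iff₀ (by positivity), mul_comm]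
    refine le_trans ?_ this
    gcongr
    have h2 : (1 + x ^ 2) ≤ (1 + |x|) ^ 2 := by
      have := sq_abs x
      have := abs_nonneg x
      nlinarith
    calc (1 + x ^ 2) ^ 3 ≤ ((1 + |x|) ^ 2) ^ 3 := by gcongr
      _ = (1 + ‖x‖) ^ 6 := by rw [Real.norm_eq_abs]; ring
  obtain ⟨C0, h0⟩ := hN 0 (by norm_num)
  obtain ⟨C1, h1⟩ := hN 1 le_rfl
  refine ⟨max (max C0 C1) 0, le_max_right _ _, fun x => ?_, fun x => ?_⟩
  · have := h0 x
    rw [norm_iteratedFDeriv_zero, Real.norm_eq_abs] at this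
    refine this.trans ?_
    gcongr
    exact (le_max_left _ _).trans (le_max_left _ _)
  · have := h1 x
    rw [norm_iteratedFDeriv_eq_norm_iteratedDeriv, iteratedDeriv_one, Real.norm_eq_abs] at this
    refine this.trans ?_
    gcongr
    exact (le_max_right _ _).trans (le_max_left _ _)

lemma moments (ψ : SchwartzMap ℝ ℝ)
    (hsupp : ∀ ξ : ℝ, (|ξ| < 2 * π / 3 ∨ 8 * π / 3 < |ξ|) → fourierT (fun x => ψ x) ξ = 0) :
    ∫ x, ψ x = 0 ∧ ∫ x, x * ψ x = 0 := by
  obtain ⟨M, hM, hb, -⟩ := schwartz_decay ψ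
  obtain ⟨i0, i1⟩ := integrable_of_decay ψ M ψ.continuous hb
  have hpi : (0:ℝ) < 2 * π / 3 := by positivity
  constructor
  · have := hsupp 0 (Or.inl (by simpa using hpi))
    unfold fourierT at this
    simp only [Complex.ofReal_zero, mul_zero, zero_mul, neg_zero, Complex.exp_zero, one_mul] at this
    rw [integral_complex_ofReal] at this
    exact_mod_cast this
  · have hd := (hasDerivAt_integral_of_dominated_loc_of_deriv_le (𝕜 := ℝ) (μ := volume)
      (F := fun (ξ : ℝ) (x : ℝ) => Complex.exp (-(Complex.I * ξ * x)) * (ψ x : ℂ))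
      (F' := fun (ξ : ℝ) (x : ℝ) =>
        Complex.exp (-(Complex.I * ξ * x)) * (-(Complex.I * x)) * (ψ x : ℂ))
      (x₀ := 0) (s := Set.univ) (bound := fun x => ‖x * ψ x‖) Filter.univ_mem
      ?_ ?_ ?_ ?_ i1.norm ?_).2
    · have hz : (fun ξ : ℝ => ∫ x : ℝ, Complex.exp (-(Complex.I * ξ * x)) * (ψ x : ℂ))
          =ᶠ[nhds 0] fun _ => 0 := by
        filter_upwards [Metric.ball_mem_nhds (0:ℝ) hpi] with ξ hξ
        apply hsupp ξ (Or.inl _)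
        simpa using hξ
      have h0 := hd.unique ((hasDerivAt_const (0:ℝ) (0:ℂ)).congr_of_eventuallyEq hz)
      have h3 : ∫ x : ℝ, (-Complex.I) * ((x * ψ x : ℝ) : ℂ) = 0 := by
        rw [← h0]
        congr 1
        ext x
        simp
        ring
      rw [integral_const_mul, integral_complex_ofReal] at h3
      have := (mul_eq_zero.mp h3).resolve_left (by simp)
      exact_mod_cast this
    · refine Filter.Eventually.of_forall fun ξ => Continuous.aestronglyMeasurable ?_
      have := ψ.continuous
      fun_prop
    · have : Integrable (fun x => ((ψ x : ℝ) : ℂ)) := i0.ofReal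
      refine this.congr (Filter.Eventually.of_forall fun x => ?_)
      simp
    · refine Continuous.aestronglyMeasurable ?_
      have := ψ.continuous
      fun_prop
    · refine Filter.Eventually.of_forall fun x ξ _ => ?_
      have : Complex.exp (-(Complex.I * ξ * x)) = Complex.exp ((-(ξ * x) : ℝ) * Complex.I) := by
        congr 1; push_cast; ring
      rw [norm_mul, norm_mul, this, Complex.norm_exp_ofReal_mul_I]
      simp
    · refine Filter.Eventually.of_forall fun x ξ _ => ?_
      have h1 : HasDerivAt (fun ξ : ℝ => -(Complex.I * (ξ:ℂ) * x)) (-(Complex.I * x)) ξ := by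
        have := (((Complex.ofRealCLM.hasDerivAt (x := ξ)).const_mul Complex.I).mul_const (x:ℂ)).neg
        refine (this.congr_deriv ?_)
        simp
      exact h1.cexp.mul_const _

lemma psi_bounds (ψ : SchwartzMap ℝ ℝ)
    (hsupp : ∀ ξ : ℝ, (|ξ| < 2 * π / 3 ∨ 8 * π / 3 < |ξ|) → fourierT (fun x => ψ x) ξ = 0)
    (θ : ℝ) (hθ : θ ∈ Ioo (0:ℝ) 1) (H : ℝ) :
    ∃ C : ℝ, 0 ≤ C ∧ (∀ y, |PsiFrac (fun x => ψ x) y θ| ≤ C * decW y) ∧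
      ∀ y h, |h| ≤ H → |PsiFrac (fun x => ψ x) (y + h) θ - PsiFrac (fun x => ψ x) y θ|
        ≤ C * |h| * decW y := by
  obtain ⟨hm0, hm1⟩ := moments ψ hsupp
  obtain ⟨M, hM, hb, hb'⟩ := schwartz_decay ψ
  obtain ⟨i0, i1⟩ := integrable_of_decay ψ M ψ.continuous hb
  obtain ⟨K, hK, hKf⟩ := frac_bound (θ - 1/2) (by linarith [hθ.1]) (by linarith [hθ.2])
  set c : ℝ := (2 * (1 + H ^ 2)) ^ 3 with hc
  have c1 : 1 ≤ c := by
    apply one_le_pow₀; nlinarith [sq_nonneg H]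
  refine ⟨K * (c * M), by positivity, fun y => ?_, fun y h hh => ?_⟩
  · refine ((hKf ψ M ψ.continuous hM hb hm0 hm1 y).2).trans ?_
    have := decW_pos y
    gcongr
    exact le_mul_of_one_le_left hM c1
  · have hψ := hKf ψ M ψ.continuous hM hb hm0 hm1
    have hcont : Continuous (fun x => ψ (x + h) - ψ x) := by
      have := ψ.continuous
      fun_prop
    have e1 : ∫ x, (ψ (x + h) - ψ x) = 0 := by
      rw [integral_sub (i0.comp_add_right h) i0, integral_add_right_eq_self (fun x => ψ x) h]
      simp
    have e2 : ∫ x, x * (ψ (x + h) - ψ x) = 0 := by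
      have : (fun x => x * (ψ (x + h) - ψ x)) =
          fun x => ((x + h) * ψ (x + h) - h * ψ (x + h)) - x * ψ x := by
        ext x; ring
      have j1 : Integrable (fun x => (x + h) * ψ (x + h)) := i1.comp_add_right h
      have j2 : Integrable (fun x => h * ψ (x + h)) := (i0.comp_add_right h).const_mul h
      have j4 : Integrable (fun x => (x + h) * ψ (x + h) - h * ψ (x + h)) := j1.sub j2
      rw [this, integral_sub j4 i1, integral_sub j1 j2, integral_const_mul,
        integral_add_right_eq_self (fun x => ψ x) h,
        integral_add_right_eq_self (fun x => x * ψ x) h, hm0, hm1]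
      simp
    have e3 : ∀ x, |ψ (x + h) - ψ x| ≤ (c * M * |h|) * ((1 + x ^ 2) ^ 3)⁻¹ := by
      intro x
      have := (convex_uIcc x (x + h)).norm_image_sub_le_of_norm_deriv_le (f := ψ)
        (C := c * M * ((1 + x ^ 2) ^ 3)⁻¹) (x := x) (y := x + h)
        (fun s _ => ψ.differentiableAt) ?_ left_mem_uIcc right_mem_uIcc
      · simp only [Real.norm_eq_abs, add_sub_cancel_left] at this
        linarith
      · intro s hs
        rw [Real.norm_eq_abs]
        refine (hb' s).trans ?_
        have hs' : |x - s| ≤ |h| := by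
          have := abs_sub_left_of_mem_uIcc hs
          rw [abs_sub_comm]
          simpa using this
        have hxs : (x - s) ^ 2 ≤ H ^ 2 := by
          rw [← sq_abs (x - s)]
          have := hs'.trans hh
          gcongr
        have hx : 1 + x ^ 2 ≤ (2 * (1 + H ^ 2)) * (1 + s ^ 2) := by
          nlinarith [sq_nonneg (x - 2 * s), mul_nonneg (sq_nonneg H) (sq_nonneg s)]
        have hx3 : (1 + x ^ 2) ^ 3 ≤ c * (1 + s ^ 2) ^ 3 := by
          rw [hc, ← mul_pow]; gcongr
        have : ((1 + s ^ 2) ^ 3)⁻¹ ≤ c * ((1 + x ^ 2) ^ 3)⁻¹ := by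
          rw [← div_eq_mul_inv, le_div_iff₀ (by positivity), inv_mul_le_iff₀ (by positivity)]
          linarith
        calc M * ((1 + s ^ 2) ^ 3)⁻¹ ≤ M * (c * ((1 + x ^ 2) ^ 3)⁻¹) := by gcongr
          _ = _ := by ring
    have hη := hKf (fun x => ψ (x + h) - ψ x) (c * M * |h|) hcont (by positivity) e3 e1 e2 y
    have tr : ∀ x, posRPow (y + h - (x + h)) (θ - 1/2) = posRPow (y - x) (θ - 1/2) := by
      intro x; congr 1; ring
    have j3 : Integrable (fun x => posRPow (y - x) (θ - 1/2) * ψ (x + h)) := by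
      have := (hψ (y + h)).1.comp_add_right h
      simpa only [tr] using this
    have e4 : PsiFrac (fun x => ψ x) (y + h) θ = ∫ x, posRPow (y - x) (θ - 1/2) * ψ (x + h) := by
      unfold PsiFrac
      rw [← integral_add_right_eq_self _ h]
      simp only [tr]
    have e5 : PsiFrac (fun x => ψ x) (y + h) θ - PsiFrac (fun x => ψ x) y θ
        = ∫ x, posRPow (y - x) (θ - 1/2) * (ψ (x + h) - ψ x) := by
      rw [e4]
      unfold PsiFrac
      rw [← integral_sub j3 (hψ y).1]
      congr 1; ext x; ring
    rw [e5]
    refine hη.2.trans (le_of_eq (by ring))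

/-- summable weight -/
def sumV (y : ℝ) : ℝ := (1 + |y|) ^ (-(5/4) : ℝ)

lemma sumV_pos (y : ℝ) : 0 < sumV y := by unfold sumV; positivity

lemma summable_sumV : Summable (fun n : ℤ => sumV (n : ℝ)) := by
  have h := (Real.summable_one_div_int_add_rpow (1/2) (5/4)).mpr (by norm_num)
  refine Summable.of_nonneg_of_le (fun n => (sumV_pos _).le) (fun n => ?_) h
  unfold sumV
  have hpos : 0 < |(n:ℝ) + 1/2| := by
    rw [abs_pos]
    intro h0
    have h1 : (2 * n + 1 : ℝ) = 0 := by linarith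
    have h2 : (2 * n + 1 : ℤ) = 0 := by exact_mod_cast h1
    omega
  rw [one_div, ← Real.rpow_neg hpos.le]
  apply Real.rpow_le_rpow_of_nonpos hpos _ (by norm_num)
  refine (abs_add_le _ _).trans ?_
  rw [abs_of_pos (by norm_num : (0:ℝ) < 1/2)]
  linarith

lemma summable_coef (ρ : ℝ) (hρ : 0 < ρ) :
    Summable (fun j : ℤ => (2 + |(j:ℝ)|) * (2:ℝ) ^ (-ρ * |(j:ℝ)|)) := by
  have hr0 : 0 < (2:ℝ) ^ (-ρ) := by positivity
  have hr : (2:ℝ) ^ (-ρ) < 1 := Real.rpow_lt_one_of_one_lt_of_neg (by norm_num) (by linarith)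
  have hn : ‖(2:ℝ) ^ (-ρ)‖ < 1 := by rwa [Real.norm_eq_abs, abs_of_pos hr0]
  have key : Summable (fun n : ℕ => (2 + |((n:ℤ):ℝ)|) * (2:ℝ) ^ (-ρ * |((n:ℤ):ℝ)|)) := by
    have h0 := (summable_geometric_of_norm_lt_one hn).mul_left 2
    have h1 := summable_pow_mul_geometric_of_norm_lt_one 1 hn
    refine (h0.add h1).congr fun n => ?_
    have : |((n:ℤ):ℝ)| = n := by simp
    rw [this, Real.rpow_mul (by norm_num), Real.rpow_natCast]
    ring
  refine Summable.of_nat_of_neg key ?_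
  simpa using key

lemma sumV_shift (Y Z : ℝ) (h : |Y - Z| ≤ 1) : sumV Y ≤ 4 * sumV Z := by
  unfold sumV
  have hz : 1 + |Z| ≤ 2 * (1 + |Y|) := by
    have h1 : |Z| ≤ |Y| + |Y - Z| := by
      have := abs_sub Y (Y - Z)
      simpa using this
    have := abs_nonneg Y
    linarith
  have h1 : (2 * (1 + |Y|)) ^ (-(5/4) : ℝ) ≤ (1 + |Z|) ^ (-(5/4) : ℝ) :=
    Real.rpow_le_rpow_of_nonpos (by positivity) hz (by norm_num)
  rw [Real.mul_rpow (by norm_num) (by positivity)] at h1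
  have h4 : (4:ℝ)⁻¹ ≤ (2:ℝ) ^ (-(5/4) : ℝ) := by
    calc (4:ℝ)⁻¹ = (2:ℝ) ^ (-2 : ℝ) := by
          rw [Real.rpow_neg (by norm_num)]; norm_num
      _ ≤ _ := Real.rpow_le_rpow_of_exponent_le (by norm_num) (by norm_num)
  have h5 : (4:ℝ)⁻¹ * (1 + |Y|) ^ (-(5/4) : ℝ) ≤ (1 + |Z|) ^ (-(5/4) : ℝ) :=
    le_trans (by gcongr) h1
  linarith

lemma weight_le (δ : ℝ) (h0 : 0 < δ) (h1 : δ ≤ 1/4) (y : ℝ) :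
    (2 + |y|) ^ δ * decW y ≤ 2 * sumV y := by
  have hy := abs_nonneg y
  have e1 : (2 + |y|) ^ δ ≤ 2 * (1 + |y|) ^ (1/4 : ℝ) := by
    calc (2 + |y|) ^ δ ≤ (2 * (1 + |y|)) ^ δ := by gcongr; linarith
      _ = 2 ^ δ * (1 + |y|) ^ δ := Real.mul_rpow (by norm_num) (by positivity)
      _ ≤ 2 ^ (1:ℝ) * (1 + |y|) ^ (1/4 : ℝ) := by
        gcongr
        · norm_num
        · linarith
        · linarith
      _ = _ := by rw [Real.rpow_one]
  have hw := decW_pos y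
  calc _ ≤ 2 * (1 + |y|) ^ (1/4 : ℝ) * decW y := by gcongr
    _ = _ := by
      unfold decW sumV
      rw [mul_assoc, ← Real.rpow_add (by positivity)]
      norm_num

lemma log_bound (C₀ δ : ℝ) (h0 : 0 < δ) (j k : ℝ) :
    C₀ * Real.sqrt (Real.log (2 + |j|) * Real.log (2 + |k|))
      ≤ |C₀| * (1 + 1 / δ) * (2 + |j|) * (2 + |k|) ^ δ := by
  have hj := abs_nonneg j
  have hk := abs_nonneg k
  have l1 : 0 ≤ Real.log (2 + |j|) := Real.log_nonneg (by linarith)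
  have s1 : Real.sqrt (Real.log (2 + |j|)) ≤ 2 + |j| := by
    rw [Real.sqrt_le_iff]
    refine ⟨by positivity, ?_⟩
    have := Real.log_le_sub_one_of_pos (by positivity : 0 < 2 + |j|)
    nlinarith
  have s2 : Real.sqrt (Real.log (2 + |k|)) ≤ (1 + 1 / δ) * (2 + |k|) ^ δ := by
    rw [Real.sqrt_le_iff]
    refine ⟨by positivity, ?_⟩
    have hl := Real.log_le_rpow_div (by positivity : 0 ≤ 2 + |k|) h0
    have hz : 1 ≤ (2 + |k|) ^ δ := Real.one_le_rpow (by linarith) h0.le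
    have hd : 0 < 1 / δ := by positivity
    refine hl.trans ?_
    calc (2 + |k|) ^ δ / δ = (1 / δ) * (2 + |k|) ^ δ := by ring
      _ ≤ (1 + 1 / δ) * (2 + |k|) ^ δ := by gcongr; linarith
      _ ≤ _ := by
        apply le_self_pow₀ _ (by norm_num)
        nlinarith
  rw [Real.sqrt_mul l1]
  calc _ ≤ |C₀| * (Real.sqrt (Real.log (2 + |j|)) * Real.sqrt (Real.log (2 + |k|))) := by
        gcongr; exact le_abs_self _
    _ ≤ |C₀| * ((2 + |j|) * ((1 + 1 / δ) * (2 + |k|) ^ δ)) := by gcongr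
    _ = _ := by ring

lemma core_bound (ψ : SchwartzMap ℝ ℝ)
    (hsupp : ∀ ξ : ℝ, (|ξ| < 2 * π / 3 ∨ 8 * π / 3 < |ξ|) → fourierT (fun x => ψ x) ξ = 0)
    (t θ : ℝ) (hθ : θ ∈ Ioo (0:ℝ) 1) : ∃ E ρ : ℝ, 0 ≤ E ∧ 0 < ρ ∧ ∀ j k : ℤ,
      (2:ℝ) ^ (-(j : ℝ) * θ) * (2 + |(k:ℝ)|) ^ (θ / 4) *
        |PsiFrac (fun x => ψ x) ((2:ℝ) ^ j * t - (k : ℝ)) θ - PsiFrac (fun x => ψ x) (-(k : ℝ)) θ|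
      ≤ E * (2:ℝ) ^ (-ρ * |(j:ℝ)|) * (sumV ((2:ℝ) ^ j * t - k) + sumV (k:ℝ)) := by
  obtain ⟨h0, h1⟩ := hθ
  obtain ⟨C, hC, hb, hl⟩ := psi_bounds ψ hsupp θ ⟨h0, h1⟩ |t|
  set δ := θ / 4 with hδ
  have δ0 : 0 < δ := by positivity
  have δ1 : δ ≤ 1/4 := by rw [hδ]; linarith
  set A := 2 + |t| with hA
  have ht := abs_nonneg t
  have hAδ : 1 ≤ A ^ δ := Real.one_le_rpow (by linarith) δ0.le
  refine ⟨2 * C * (A ^ δ + |t|), min (3 * δ) (1 - θ), by positivity, ?_, ?_⟩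
  · apply lt_min <;> linarith
  intro j k
  have hwk : (2 + |(k:ℝ)|) ^ δ * decW (-(k:ℝ)) ≤ 2 * sumV (k:ℝ) := by
    have := weight_le δ δ0 δ1 (-(k:ℝ))
    simpa [sumV, decW] using this
  set Y := (2:ℝ) ^ j * t - k with hY
  have hwY := weight_le δ δ0 δ1 Y
  have vY := sumV_pos Y
  have vk := sumV_pos (k:ℝ)
  have wY := decW_pos Y
  have wk := decW_pos (-(k:ℝ))
  have hz : (2:ℝ) ^ j = (2:ℝ) ^ (j:ℝ) := (Real.rpow_intCast 2 j).symm
  rcases le_or_gt 0 j with hj | hj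
  · have hjR : (0:ℝ) ≤ j := by exact_mod_cast hj
    have p1 : (1:ℝ) ≤ (2:ℝ) ^ j := one_le_zpow₀ (by norm_num) hj
    have q1 : 2 + |(k:ℝ)| ≤ (2:ℝ) ^ j * A * (2 + |Y|) := by
      have : |(k:ℝ)| ≤ (2:ℝ) ^ j * |t| + |Y| := by
        have h5 := abs_sub ((2:ℝ) ^ j * t) Y
        rw [abs_mul, abs_of_pos (by positivity : (0:ℝ) < 2 ^ j)] at h5
        simpa [hY] using h5
      have hYn := abs_nonneg Y
      have z1 : 0 ≤ (2:ℝ) ^ j * |t| := by positivity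
      have z2 : 0 ≤ (2:ℝ) ^ j * |t| * |Y| := by positivity
      have z3 : |Y| ≤ (2:ℝ) ^ j * |Y| := le_mul_of_one_le_left hYn p1
      rw [hA]
      nlinarith
    have q2 : (2 + |(k:ℝ)|) ^ δ ≤ (2:ℝ) ^ (j * δ) * A ^ δ * (2 + |Y|) ^ δ := by
      calc _ ≤ ((2:ℝ) ^ j * A * (2 + |Y|)) ^ δ := by gcongr
        _ = _ := by
          rw [Real.mul_rpow (by positivity) (by positivity),
            Real.mul_rpow (by positivity) (by positivity), hz, ← Real.rpow_mul (by norm_num)]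
    have q3 : 1 ≤ (2:ℝ) ^ (j * δ) := Real.one_le_rpow (by norm_num) (by positivity)
    have d1 : |PsiFrac (fun x => ψ x) Y θ - PsiFrac (fun x => ψ x) (-(k : ℝ)) θ|
        ≤ C * decW Y + C * decW (-(k:ℝ)) :=
      (abs_sub _ _).trans (add_le_add (hb _) (hb _))
    have d2 : (2 + |(k:ℝ)|) ^ δ * (decW Y + decW (-(k:ℝ))) ≤
        (2:ℝ) ^ (j * δ) * A ^ δ * (2 * (sumV Y + sumV (k:ℝ))) := by
      have u1 : (2 + |(k:ℝ)|) ^ δ * decW Y ≤ (2:ℝ) ^ (j * δ) * A ^ δ * (2 * sumV Y) := by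
        calc _ ≤ ((2:ℝ) ^ (j * δ) * A ^ δ * (2 + |Y|) ^ δ) * decW Y := by gcongr
          _ = (2:ℝ) ^ (j * δ) * A ^ δ * ((2 + |Y|) ^ δ * decW Y) := by ring
          _ ≤ _ := by gcongr
      have u2 : (2 + |(k:ℝ)|) ^ δ * decW (-(k:ℝ)) ≤
          (2:ℝ) ^ (j * δ) * A ^ δ * (2 * sumV (k:ℝ)) := by
        refine hwk.trans (le_mul_of_one_le_left (by positivity) ?_)
        exact one_le_mul_of_one_le_of_one_le q3 hAδ
      linarith
    have d3 : (2:ℝ) ^ (-(j : ℝ) * θ) * (2:ℝ) ^ (j * δ) ≤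
        (2:ℝ) ^ (-(min (3 * δ) (1 - θ)) * |(j:ℝ)|) := by
      rw [← Real.rpow_add (by norm_num)]
      apply Real.rpow_le_rpow_of_exponent_le (by norm_num)
      rw [abs_of_nonneg hjR]
      have : min (3 * δ) (1 - θ) * j ≤ 3 * δ * j := by gcongr; exact min_le_left _ _
      have : (j:ℝ) * θ = 4 * (j * δ) := by rw [hδ]; ring
      linarith
    calc _ ≤ (2:ℝ) ^ (-(j : ℝ) * θ) * (2 + |(k:ℝ)|) ^ δ * (C * decW Y + C * decW (-(k:ℝ))) := by
          gcongr
      _ = (2:ℝ) ^ (-(j : ℝ) * θ) * C * ((2 + |(k:ℝ)|) ^ δ * (decW Y + decW (-(k:ℝ)))) := by ring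
      _ ≤ (2:ℝ) ^ (-(j : ℝ) * θ) * C *
          ((2:ℝ) ^ (j * δ) * A ^ δ * (2 * (sumV Y + sumV (k:ℝ)))) := by gcongr
      _ = (2 * C * A ^ δ) * ((2:ℝ) ^ (-(j : ℝ) * θ) * (2:ℝ) ^ (j * δ)) *
          (sumV Y + sumV (k:ℝ)) := by ring
      _ ≤ _ := by
        gcongr
        linarith
  · have hjR : (j:ℝ) < 0 := by exact_mod_cast hj
    have p1 : (2:ℝ) ^ j ≤ 1 := zpow_le_one_of_nonpos₀ (by norm_num) hj.le
    have habs : |(2:ℝ) ^ j * t| = (2:ℝ) ^ j * |t| := by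
      rw [abs_mul, abs_of_pos (by positivity : (0:ℝ) < 2 ^ j)]
    have d1 := hl (-(k:ℝ)) ((2:ℝ) ^ j * t) (by
      rw [habs]; exact mul_le_of_le_one_left ht p1)
    have hYe : -(k:ℝ) + (2:ℝ) ^ j * t = Y := by rw [hY]; ring
    rw [hYe, habs] at d1
    have d3 : (2:ℝ) ^ (-(j : ℝ) * θ) * (2:ℝ) ^ j ≤
        (2:ℝ) ^ (-(min (3 * δ) (1 - θ)) * |(j:ℝ)|) := by
      rw [hz, ← Real.rpow_add (by norm_num)]
      apply Real.rpow_le_rpow_of_exponent_le (by norm_num)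
      rw [abs_of_neg hjR]
      have : min (3 * δ) (1 - θ) * (-j) ≤ (1 - θ) * (-j) :=
        mul_le_mul_of_nonneg_right (min_le_right _ _) (by linarith)
      linarith
    calc _ ≤ (2:ℝ) ^ (-(j : ℝ) * θ) * (2 + |(k:ℝ)|) ^ δ *
          (C * ((2:ℝ) ^ j * |t|) * decW (-(k:ℝ))) := by gcongr
      _ = (C * |t|) * ((2:ℝ) ^ (-(j : ℝ) * θ) * (2:ℝ) ^ j) *
          ((2 + |(k:ℝ)|) ^ δ * decW (-(k:ℝ))) := by ring
      _ ≤ (C * |t|) * (2:ℝ) ^ (-(min (3 * δ) (1 - θ)) * |(j:ℝ)|) * (2 * sumV (k:ℝ)) := by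
        gcongr
      _ = 2 * C * |t| * (2:ℝ) ^ (-(min (3 * δ) (1 - θ)) * |(j:ℝ)|) * sumV (k:ℝ) := by ring
      _ ≤ _ := by
        gcongr
        · linarith
        · linarith

lemma summable_dom_aux (c g : ℤ → ℝ) (hc0 : ∀ j, 0 ≤ c j) (hc : Summable c)
    (hg0 : ∀ j, 0 ≤ g j) (hg : Summable g) (n : ℤ → ℤ) :
    Summable (fun jk : ℤ × ℤ => c jk.1 * g (n jk.1 - jk.2)) := by
  have h : Summable (fun p : ℤ × ℤ => c p.1 * g p.2) := hc.mul_of_nonneg hg hc0 hg0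
  have hinj : Function.Injective (fun jk : ℤ × ℤ => (jk.1, n jk.1 - jk.2)) := by
    intro p q hh
    obtain ⟨h1, h2⟩ := Prod.mk.inj hh
    rw [h1] at h2
    exact Prod.ext h1 (by omega)
  exact h.comp_injective hinj

lemma summable_dom (c : ℤ → ℝ) (hc0 : ∀ j, 0 ≤ c j) (hc : Summable c) (n : ℤ → ℤ) :
    Summable (fun jk : ℤ × ℤ => c jk.1 * sumV ((n jk.1 - jk.2 : ℤ) : ℝ)) :=
  summable_dom_aux c (fun m => sumV (m : ℝ)) hc0 hc (fun _ => (sumV_pos _).le) summable_sumV n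

/-- Absolute convergence of the wavelet-type series defining the modification `B̃` of
the generating field of multifractional Brownian motion: for coefficients
`(ε_{j,k})` with the logarithmic bound, the series
`Σ_{(j,k)} 2^{−jθ} |ε_{j,k}| |Ψ(2^j t − k, θ) − Ψ(−k, θ)|` converges; consequently
the signed series is (unconditionally) summable. -/
theorem wavelet_series_absolutely_convergent (ψ : SchwartzMap ℝ ℝ)
    (hsupp : ∀ ξ : ℝ, (|ξ| < 2 * π / 3 ∨ 8 * π / 3 < |ξ|) → fourierT (fun x => ψ x) ξ = 0)
    (e : ℤ × ℤ → ℝ) (C₀ : ℝ)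
    (hbd : ∀ j k : ℤ, |e (j, k)|
      ≤ C₀ * Real.sqrt (Real.log (2 + |(j : ℝ)|) * Real.log (2 + |(k : ℝ)|))) :
    ∀ t : ℝ, ∀ θ ∈ Set.Ioo (0:ℝ) 1,
      Summable (fun jk : ℤ × ℤ => (2:ℝ) ^ (-(jk.1 : ℝ) * θ) * |e jk|
        * |PsiFrac (fun x => ψ x) ((2:ℝ) ^ jk.1 * t - (jk.2 : ℝ)) θ
            - PsiFrac (fun x => ψ x) (-(jk.2 : ℝ)) θ|) ∧
      Summable (fun jk : ℤ × ℤ => (2:ℝ) ^ (-(jk.1 : ℝ) * θ) * e jk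
        * (PsiFrac (fun x => ψ x) ((2:ℝ) ^ jk.1 * t - (jk.2 : ℝ)) θ
            - PsiFrac (fun x => ψ x) (-(jk.2 : ℝ)) θ)) := by
  intro t θ hθ
  have main : Summable (fun jk : ℤ × ℤ => (2:ℝ) ^ (-(jk.1 : ℝ) * θ) * |e jk|
        * |PsiFrac (fun x => ψ x) ((2:ℝ) ^ jk.1 * t - (jk.2 : ℝ)) θ
            - PsiFrac (fun x => ψ x) (-(jk.2 : ℝ)) θ|) := by
    obtain ⟨E, ρ, hE, hρ, hcore⟩ := core_bound ψ hsupp t θ hθ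
    have δ0 : 0 < θ / 4 := by linarith [hθ.1]
    set G := |C₀| * (1 + 1 / (θ / 4)) with hG
    have hG0 : 0 ≤ G := by positivity
    set c : ℤ → ℝ := fun j => (2 + |(j:ℝ)|) * (2:ℝ) ^ (-ρ * |(j:ℝ)|) with hc
    have hc0 : ∀ j, 0 ≤ c j := fun j => by rw [hc]; positivity
    have hcs : Summable c := summable_coef ρ hρ
    have s1 := summable_dom c hc0 hcs (fun j => ⌊(2:ℝ) ^ j * t⌋)
    have s2 := summable_dom c hc0 hcs (fun _ => 0)
    refine Summable.of_nonneg_of_le (fun jk => by positivity) (fun jk => ?_)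
      (((s1.mul_left 4).add s2).mul_left (G * E))
    obtain ⟨j, k⟩ := jk
    have he := (hbd j k).trans (log_bound C₀ (θ / 4) δ0 j k)
    have hk := hcore j k
    have hv1 : sumV ((2:ℝ) ^ j * t - k) ≤ 4 * sumV ((⌊(2:ℝ) ^ j * t⌋ - k : ℤ) : ℝ) := by
      apply sumV_shift
      push_cast
      have u1 := Int.floor_le ((2:ℝ) ^ j * t)
      have u2 := Int.lt_floor_add_one ((2:ℝ) ^ j * t)
      rw [abs_le]
      constructor <;> linarith
    have hv2 : sumV (k:ℝ) = sumV ((0 - k : ℤ) : ℝ) := by simp [sumV]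
    simp only
    calc _ ≤ (2:ℝ) ^ (-(j : ℝ) * θ) * (G * (2 + |(j:ℝ)|) * (2 + |(k:ℝ)|) ^ (θ / 4)) *
          |PsiFrac (fun x => ψ x) ((2:ℝ) ^ j * t - (k : ℝ)) θ
            - PsiFrac (fun x => ψ x) (-(k : ℝ)) θ| := by gcongr
      _ = G * (2 + |(j:ℝ)|) * ((2:ℝ) ^ (-(j : ℝ) * θ) * (2 + |(k:ℝ)|) ^ (θ / 4) *
          |PsiFrac (fun x => ψ x) ((2:ℝ) ^ j * t - (k : ℝ)) θ
            - PsiFrac (fun x => ψ x) (-(k : ℝ)) θ|) := by ring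
      _ ≤ G * (2 + |(j:ℝ)|) * (E * (2:ℝ) ^ (-ρ * |(j:ℝ)|) *
          (sumV ((2:ℝ) ^ j * t - k) + sumV (k:ℝ))) := by gcongr
      _ = G * E * c j * (sumV ((2:ℝ) ^ j * t - k) + sumV (k:ℝ)) := by rw [hc]; ring
      _ ≤ G * E * c j * (4 * sumV ((⌊(2:ℝ) ^ j * t⌋ - k : ℤ) : ℝ) + sumV ((0 - k : ℤ) : ℝ)) := by
        rw [hv2]
        have := hc0 j
        gcongr
      _ = _ := by ring
  refine ⟨main, ?_⟩
  refine Summable.of_norm (main.congr fun jk => ?_)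
  rw [norm_mul, norm_mul, Real.norm_eq_abs, Real.norm_eq_abs, Real.norm_eq_abs,
    abs_of_pos (by positivity : (0:ℝ) < (2:ℝ) ^ (-(jk.1 : ℝ) * θ))]

end
end

section
/- Let ψ : ℝ → ℝ be a real-valued Schwartz function whose Fourier transform ψ̂(ξ) = ∫_ℝ e^{−iξx} ψ(x) dx vanishes outside { ξ : 2π/3 ≤ |ξ| ≤ 8π/3 }, and let Ψ(y,θ) = ∫_ℝ (y−x)₊^{θ−1/2} ψ(x) dx. Let (ε_{j,k})_{(j,k)∈ℤ²} be real numbers with |ε_{j,k}| ≤ C₀ √( log(2+|j|) log(2+|k|) ) for some C₀ < ∞ and all (j,k). Then: (i) for every j ∈ ℤ the series S_j(y,θ) = Σ_{k∈ℤ} ε_{j,k} Ψ(y−k,θ) defines a C^∞ function on ℝ × (0,1) whose partial derivatives are obtained by termwise differentiation, ∂_y^m ∂_θ^n S_j(y,θ) = Σ_{k∈ℤ} ε_{j,k} ∂_y^m ∂_θ^n Ψ(y−k,θ); and (ii) for all reals 0 < a < b < 1 and all nonnegative integers m, n, there exists a constant C < ∞, depending only on a, b, m, n and the sequence (ε_{j,k}),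 such that for all j ∈ ℤ and all z > 0: sup{ Σ_{k∈ℤ} |ε_{j,k}| |∂_y^m ∂_θ^n Ψ(y−k,θ)| : (y,θ) ∈ [−z,z] × [a,b] } ≤ C √( log(2+z) log(2+|j|) ). -/
open MeasureTheory Set Real

noncomputable section

/-- The iterated partial derivative `∂_y^m ∂_θ^n F(y,θ)`, the `θ`-derivatives being
taken within `(0,1)`. -/
def pder (F : ℝ → ℝ → ℝ) (m n : ℕ) (y θ : ℝ) : ℝ :=
  iteratedDeriv m (fun y' => iteratedDerivWithin n (fun θ' => F y' θ') (Set.Ioo 0 1) θ) y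

/-- `S_j(y,θ) = Σ_{k∈ℤ} ε_{j,k} Ψ(y−k,θ)`. -/
def Sfun (ψ : ℝ → ℝ) (e : ℤ × ℤ → ℝ) (j : ℤ) (y θ : ℝ) : ℝ :=
  ∑' k : ℤ, e (j, k) * PsiFrac ψ (y - (k : ℝ)) θ

section aux

open scoped Topology ContDiff SchwartzMap FourierTransform

theorem fam_iterθ (H : ℕ → ℕ → ℝ → ℝ → ℝ)
    (hθ : ∀ m n y, ∀ θ ∈ Ioo (0:ℝ) 1, HasDerivAt (fun t => H m n y t) (H m (n+1) y θ) θ)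
    (y : ℝ) (n : ℕ) : ∀ θ ∈ Ioo (0:ℝ) 1,
    iteratedDerivWithin n (fun t => H 0 0 y t) (Ioo 0 1) θ = H 0 n y θ := by
  induction n with
  | zero => intro θ _; simp
  | succ n ih =>
    intro θ h
    rw [iteratedDerivWithin_succ, derivWithin_congr ih (ih θ h)]
    exact (hθ 0 n y θ h).hasDerivWithinAt.derivWithin (isOpen_Ioo.uniqueDiffWithinAt h)

theorem fam_pder (F : ℝ → ℝ → ℝ) (H : ℕ → ℕ → ℝ → ℝ → ℝ)
    (hF : ∀ y, ∀ θ ∈ Ioo (0:ℝ) 1, F y θ = H 0 0 y θ)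
    (hy : ∀ m n y, ∀ θ ∈ Ioo (0:ℝ) 1, HasDerivAt (fun t => H m n t θ) (H (m+1) n y θ) y)
    (hθ : ∀ m n y, ∀ θ ∈ Ioo (0:ℝ) 1, HasDerivAt (fun t => H m n y t) (H m (n+1) y θ) θ)
    (m n : ℕ) (y θ : ℝ) (h : θ ∈ Ioo (0:ℝ) 1) : pder F m n y θ = H m n y θ := by
  unfold pder
  have h1 : (fun y' => iteratedDerivWithin n (fun θ' => F y' θ') (Ioo 0 1) θ)
      = fun y' => H 0 n y' θ := by
    funext y'
    rw [← fam_iterθ H hθ y' n θ h]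
    exact iteratedDerivWithin_congr (fun t ht => hF y' t ht) h
  rw [h1]
  induction m generalizing y with
  | zero => simp
  | succ m ih =>
    rw [iteratedDeriv_succ, funext ih]
    exact (hy m n y θ h).deriv

theorem fam_cont (H : ℕ → ℕ → ℝ → ℝ → ℝ)
    (hy : ∀ m n y, ∀ θ ∈ Ioo (0:ℝ) 1, HasDerivAt (fun t => H m n t θ) (H (m+1) n y θ) y)
    (hθ : ∀ m n y, ∀ θ ∈ Ioo (0:ℝ) 1, HasDerivAt (fun t => H m n y t) (H m (n+1) y θ) θ)
    (hb : ∀ m n z a b, 0 < a → b < 1 → ∃ C : ℝ, ∀ y ∈ Icc (-z) z, ∀ θ ∈ Icc a b, |H m n y θ| ≤ C)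
    (m n : ℕ) (y θ : ℝ) (h : θ ∈ Ioo (0:ℝ) 1) :
    ContinuousAt (fun p : ℝ × ℝ => H m n p.1 p.2) (y, θ) := by
  obtain ⟨C, hC⟩ := hb (m+1) n (|y|+1) (θ/2) ((θ+1)/2) (by linarith [h.1]) (by linarith [h.2])
  have hsub : ∀ t ∈ Ioo (θ/2) ((θ+1)/2), t ∈ Ioo (0:ℝ) 1 := fun t ht =>
    ⟨by linarith [ht.1, h.1], by linarith [ht.2, h.2]⟩
  have := continuousOn_prod_of_continuousOn_lipschitzOnWith
    (fun p : ℝ × ℝ => H m n p.1 p.2) (s := Ioo (-(|y|+1)) (|y|+1)) (t := Ioo (θ/2) ((θ+1)/2))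
    C.toNNReal ?_ ?_
  · refine this.continuousAt ((isOpen_Ioo.prod isOpen_Ioo).mem_nhds ⟨⟨?_, ?_⟩, ⟨?_, ?_⟩⟩)
    · have := neg_abs_le y; dsimp; linarith
    · have := le_abs_self y; dsimp; linarith
    · dsimp; linarith [h.1]
    · dsimp; linarith [h.2]
  · intro y' _ t ht
    exact (hθ m n y' t (hsub t ht)).continuousAt.continuousWithinAt
  · intro t ht
    refine (convex_Ioo _ _).lipschitzOnWith_of_nnnorm_hasDerivWithin_le
      (fun x _ => (hy m n x t (hsub t ht)).hasDerivWithinAt) ?_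
    intro x hx
    have h1 := hC x ⟨hx.1.le, hx.2.le⟩ t ⟨ht.1.le, ht.2.le⟩
    rw [← NNReal.coe_le_coe, coe_nnnorm, Real.norm_eq_abs]
    exact h1.trans (Real.le_coe_toNNReal C)

theorem fam_contDiff (H : ℕ → ℕ → ℝ → ℝ → ℝ)
    (hy : ∀ m n y, ∀ θ ∈ Ioo (0:ℝ) 1, HasDerivAt (fun t => H m n t θ) (H (m+1) n y θ) y)
    (hθ : ∀ m n y, ∀ θ ∈ Ioo (0:ℝ) 1, HasDerivAt (fun t => H m n y t) (H m (n+1) y θ) θ)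
    (hb : ∀ m n z a b, 0 < a → b < 1 → ∃ C : ℝ, ∀ y ∈ Icc (-z) z, ∀ θ ∈ Icc a b, |H m n y θ| ≤ C)
    (N : ℕ) : ∀ m n : ℕ,
    ContDiffOn ℝ N (fun p : ℝ × ℝ => H m n p.1 p.2) (univ ×ˢ Ioo (0:ℝ) 1) := by
  have hc := fam_cont H hy hθ hb
  have ho : IsOpen ((univ : Set ℝ) ×ˢ Ioo (0:ℝ) 1) := isOpen_univ.prod isOpen_Ioo
  have hd : ∀ m n, ∀ p ∈ (univ : Set ℝ) ×ˢ Ioo (0:ℝ) 1,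
      HasFDerivAt (fun p : ℝ × ℝ => H m n p.1 p.2)
        (H (m+1) n p.1 p.2 • ContinuousLinearMap.fst ℝ ℝ ℝ
          + H m (n+1) p.1 p.2 • ContinuousLinearMap.snd ℝ ℝ ℝ) p := by
    rintro m n ⟨y, θ⟩ hp
    have h := hasStrictFDerivAt_uncurry_coprod (𝕜 := ℝ) (u := (y, θ)) (f := H m n)
      (f₁ := fun y θ => H (m+1) n y θ • (1 : ℝ →L[ℝ] ℝ))
      (f₂ := fun y θ => H m (n+1) y θ • (1 : ℝ →L[ℝ] ℝ)) ?_ ?_ ?_ ?_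
    · convert! h.hasFDerivAt using 1
    · filter_upwards [ho.mem_nhds hp] with v hv
      have := (hy m n v.1 v.2 hv.2).hasFDerivAt
      convert! this using 1
      ext; simp [Function.HasUncurry.uncurry]
    · filter_upwards [ho.mem_nhds hp] with v hv
      have := (hθ m n v.1 v.2 hv.2).hasFDerivAt
      convert! this using 1
      ext; simp [Function.HasUncurry.uncurry]
    · exact (hc (m+1) n y θ hp.2).smul continuousAt_const
    · exact (hc m (n+1) y θ hp.2).smul continuousAt_const
  induction N with
  | zero =>
    intro m n
    rw [Nat.cast_zero, contDiffOn_zero]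
    intro p hp
    exact (hc m n p.1 p.2 hp.2).continuousWithinAt
  | succ N ih =>
    intro m n
    rw [Nat.cast_succ, contDiffOn_succ_iff_fderiv_of_isOpen ho]
    refine ⟨fun p hp => (hd m n p hp).differentiableAt.differentiableWithinAt, by simp, ?_⟩
    refine ContDiffOn.congr ?_ (fun p hp => (hd m n p hp).fderiv)
    exact ((ih (m+1) n).smul contDiffOn_const).add ((ih m (n+1)).smul contDiffOn_const)

theorem schwartz_D_iter (f : 𝓢(ℝ, ℝ)) (n : ℕ) :
    (⇑((SchwartzMap.derivCLM ℝ ℝ)^[n] f) : ℝ → ℝ) = iteratedDeriv n f := by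
  induction n with
  | zero => simp
  | succ n ih =>
    rw [Function.iterate_succ_apply', iteratedDeriv_succ, ← ih]
    funext x; simp

theorem exists_primitive (ψ : 𝓢(ℝ, ℝ))
    (hsupp : ∀ ξ : ℝ, (|ξ| < 2 * π / 3 ∨ 8 * π / 3 < |ξ|) → fourierT (fun x => ψ x) ξ = 0)
    (N : ℕ) : ∃ g : 𝓢(ℝ, ℝ), (SchwartzMap.derivCLM ℝ ℝ)^[N] g = ψ := by
  let ψc : 𝓢(ℝ, ℂ) := ψ.postcompCLM Complex.ofRealCLM
  have hψc : ∀ x, ψc x = (ψ x : ℂ) := fun x => rfl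
  let f : 𝓢(ℝ, ℂ) := 𝓕 ψc
  have hf : ∀ ξ : ℝ, f ξ = fourierT (fun x => ψ x) (2 * π * ξ) := by
    intro ξ
    change (𝓕 (ψc : ℝ → ℂ)) ξ = _
    rw [Real.fourier_real_eq_integral_exp_smul]
    unfold fourierT
    congr 1
    funext x
    rw [hψc, smul_eq_mul]
    congr 2
    push_cast
    ring
  have hf0 : ∀ ξ : ℝ, |ξ| < 1/3 → f ξ = 0 := by
    intro ξ h
    rw [hf]
    apply hsupp
    left
    rw [abs_mul, abs_of_pos Real.two_pi_pos]
    nlinarith [Real.pi_pos]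
  have hf1 : ∀ ξ : ℝ, 4/3 < |ξ| → f ξ = 0 := by
    intro ξ h
    rw [hf]
    apply hsupp
    right
    rw [abs_mul, abs_of_pos Real.two_pi_pos]
    nlinarith [Real.pi_pos]
  let q : ℝ → ℂ := fun ξ => f ξ / (2 * π * Complex.I * ξ) ^ N
  have hq1 : HasCompactSupport q := by
    refine HasCompactSupport.intro (isCompact_Icc (a := (-(4/3) : ℝ)) (b := 4/3)) ?_
    intro x hx
    have : 4/3 < |x| := by
      by_contra! h
      exact hx (abs_le.mp h)
    simp [q, hf1 x this]
  have hq2 : ContDiff ℝ ∞ q := by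
    rw [contDiff_iff_contDiffAt]
    intro x
    by_cases hx : x = 0
    · have : q =ᶠ[𝓝 x] fun _ => 0 := by
        have : {t : ℝ | |t| < 1/3} ∈ 𝓝 x := by
          apply (isOpen_lt continuous_abs continuous_const).mem_nhds
          simp [hx]
        filter_upwards [this] with t ht
        simp [q, hf0 t ht]
      exact contDiffAt_const.congr_of_eventuallyEq this
    · have h1 : ContDiffAt ℝ ∞ (fun ξ : ℝ => (2 * π * Complex.I * ξ) ^ N) x := by
        have : ContDiff ℝ ∞ (fun ξ : ℝ => (ξ : ℂ)) := Complex.ofRealCLM.contDiff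
        exact ((contDiff_const.mul this).pow N).contDiffAt
      have h2 : ContDiffAt ℝ ∞ f x := f.smooth'.contDiffAt
      have h3 : (2 * π * Complex.I * x) ^ N ≠ 0 := by
        apply pow_ne_zero
        simp [hx, Real.pi_ne_zero]
      have h4 := h2.mul (h1.inv h3)
      exact h4.congr_of_eventuallyEq (Filter.Eventually.of_forall fun t => div_eq_mul_inv _ _)
  let h : 𝓢(ℝ, ℂ) := hq1.toSchwartzMap hq2
  have hh : ∀ x, h x = q x := fun x => rfl
  let g : 𝓢(ℝ, ℂ) := 𝓕⁻ h
  have hg : 𝓕 g = h := by simp [g]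
  have hD : ∀ n, (⇑((SchwartzMap.derivCLM ℝ ℂ)^[n] g) : ℝ → ℂ) = iteratedDeriv n g := by
    intro n
    induction n with
    | zero => simp
    | succ n ih =>
      rw [Function.iterate_succ_apply', iteratedDeriv_succ, ← ih]
      funext x; simp
  have key : (SchwartzMap.derivCLM ℝ ℂ)^[N] g = ψc := by
    have : 𝓕 ((SchwartzMap.derivCLM ℝ ℂ)^[N] g) = 𝓕 ψc := by
      ext ξ
      rw [SchwartzMap.fourier_coe, hD, Real.fourier_iteratedDeriv (f := ⇑g) (N := ⊤) (g.smooth ⊤) ?_ (by simp)]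
      · rw [← SchwartzMap.fourier_coe, hg]
        change _ • q ξ = f ξ
        simp only [q, smul_eq_mul]
        by_cases hx : ξ = 0
        · rw [hf0 ξ (by simp [hx])]; simp
        · rw [← mul_div_assoc]
          exact mul_div_cancel_left₀ _ (pow_ne_zero _ (by simp [hx, Real.pi_ne_zero]))
      · intro n _
        rw [← hD]
        exact SchwartzMap.integrable _
    have h2 := congrArg (fun F : 𝓢(ℝ, ℂ) => 𝓕⁻ F) this
    simpa using h2
  refine ⟨g.postcompCLM Complex.reCLM, ?_⟩
  have hre : ∀ n, ∀ x, (SchwartzMap.derivCLM ℝ ℝ)^[n] (g.postcompCLM Complex.reCLM) x =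
     ((SchwartzMap.derivCLM ℝ ℂ)^[n] g x).re := by
    intro n
    induction n with
    | zero => intro x; rfl
    | succ n ih =>
      intro x
      rw [Function.iterate_succ_apply', Function.iterate_succ_apply', SchwartzMap.derivCLM_apply,
        SchwartzMap.derivCLM_apply, funext ih]
      have := ((SchwartzMap.derivCLM ℝ ℂ)^[n] g).differentiableAt (x := x)
      exact (Complex.reCLM.hasFDerivAt.comp_hasDerivAt x this.hasDerivAt).deriv
  ext x
  rw [hre, key, hψc, Complex.ofReal_re]

def wt (x : ℝ) : ℝ := ((1 + x^2)^2)⁻¹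

theorem wt_pos (x : ℝ) : 0 < wt x := by unfold wt; positivity

theorem wt_sub_le (y u : ℝ) : wt (y - u) ≤ 4 * (1 + u^2)^2 * wt y := by
  unfold wt
  have h1 : 1 + y^2 ≤ 2 * (1+u^2) * (1 + (y-u)^2) := by
    nlinarith [sq_nonneg (y - 2 * u), mul_nonneg (sq_nonneg u) (sq_nonneg (y-u))]
  have h2 : (1 + y^2)^2 ≤ (2 * (1+u^2) * (1 + (y-u)^2))^2 := by gcongr
  rw [← div_eq_mul_inv, le_div_iff₀ (by positivity), inv_mul_le_iff₀ (by positivity)]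
  linarith

theorem wt_sub_le' (y u : ℝ) : wt (y - u) ≤ 4 * (1 + y^2)^2 * wt u := by
  have := wt_sub_le u y
  rwa [show wt (u - y) = wt (y - u) by unfold wt; ring_nf] at this

theorem schwartz_wt (f : 𝓢(ℝ, ℝ)) : ∃ C : ℝ, 0 ≤ C ∧ ∀ x, |f x| ≤ C * wt x := by
  obtain ⟨C0, h0, hC0⟩ := f.decay 0 0
  obtain ⟨C4, h4, hC4⟩ := f.decay 4 0
  refine ⟨2 * C0 + 2 * C4, by positivity, fun x => ?_⟩
  have e0 := hC0 x
  have e4 := hC4 x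
  simp only [norm_iteratedFDeriv_zero, Real.norm_eq_abs, pow_zero, one_mul] at e0 e4
  rw [show |x|^4 = x^4 by rw [show 4 = 2*2 by rfl, pow_mul, sq_abs, ← pow_mul]] at e4
  unfold wt
  rw [← div_eq_mul_inv, le_div_iff₀ (by positivity)]
  nlinarith [mul_nonneg (abs_nonneg (f x)) (sq_nonneg (x^2 - 1))]

theorem log_small (c : ℝ) (hc : 0 < c) (n : ℕ) : ∃ C : ℝ, 0 ≤ C ∧ ∀ u : ℝ, 0 < u → u ≤ 1 →
    u ^ c * |log u| ^ n ≤ C := by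
  have ht : 0 < c / (n+1) := by positivity
  refine ⟨(1 / (c/(n+1)))^n, by positivity, fun u h0 h1 => ?_⟩
  have h2 := (Real.abs_log_mul_self_rpow_lt u _ h0 h1 ht).le
  rw [abs_mul, abs_of_pos (rpow_pos_of_pos h0 _)] at h2
  have h3 : u ^ c ≤ (u ^ (c/(n+1)))^n := by
    rw [← Real.rpow_natCast, ← Real.rpow_mul h0.le]
    apply Real.rpow_le_rpow_of_exponent_ge h0 h1
    rw [div_mul_eq_mul_div, div_le_iff₀ (by positivity)]
    nlinarith
  calc u ^ c * |log u| ^ n ≤ (u ^ (c/(n+1)))^n * |log u| ^ n := by gcongr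
    _ = (|log u| * u ^ (c/(n+1)))^n := by rw [mul_pow]; ring
    _ ≤ _ := by gcongr

theorem log_large (c : ℝ) (hc : 0 < c) (n : ℕ) : ∃ C : ℝ, 0 ≤ C ∧ ∀ u : ℝ, 1 ≤ u →
    |log u| ^ n ≤ C * u ^ c := by
  obtain ⟨C, hC, h⟩ := log_small c hc n
  refine ⟨C, hC, fun u hu => ?_⟩
  have h0 : 0 < u := by linarith
  have := h u⁻¹ (by positivity) (inv_le_one_of_one_le₀ hu)
  rw [Real.log_inv, abs_neg, Real.inv_rpow h0.le, inv_mul_le_iff₀ (rpow_pos_of_pos h0 _)] at this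
  linarith

theorem ker_bound (a b : ℝ) (ha : 0 < a) (hb : b < 1) (n : ℕ) : ∃ C : ℝ, 0 ≤ C ∧
    ∀ θ ∈ Icc a b, ∀ u : ℝ, 0 < u →
    u ^ (θ - 1/2) * |log u| ^ n ≤ C * (u ^ (-(1/2) : ℝ) + u ^ (1/2 : ℝ)) := by
  obtain ⟨C1, hC1, h1⟩ := log_small a ha n
  obtain ⟨C2, hC2, h2⟩ := log_large (1 - b) (by linarith) n
  refine ⟨C1 + C2, by positivity, fun θ hθ u hu => ?_⟩
  have p1 : 0 < u ^ (-(1/2) : ℝ) := rpow_pos_of_pos hu _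
  have p2 : 0 < u ^ (1/2 : ℝ) := rpow_pos_of_pos hu _
  rcases le_total u 1 with h | h
  · have := h1 u hu h
    calc u ^ (θ - 1/2) * |log u| ^ n = u ^ (-(1/2) : ℝ) * (u ^ θ * |log u| ^ n) := by
          rw [← mul_assoc, ← Real.rpow_add hu]; ring_nf
      _ ≤ u ^ (-(1/2) : ℝ) * (u ^ a * |log u| ^ n) := by
          have := Real.rpow_le_rpow_of_exponent_ge hu h hθ.1
          gcongr
      _ ≤ u ^ (-(1/2) : ℝ) * C1 := by gcongr
      _ ≤ _ := by nlinarith [mul_nonneg hC2 p1.le, mul_nonneg hC2 p2.le, mul_nonneg hC1 p2.le]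
  · have := h2 u h
    calc u ^ (θ - 1/2) * |log u| ^ n ≤ u ^ (b - 1/2) * (C2 * u ^ (1-b)) := by
          have := Real.rpow_le_rpow_of_exponent_le h (sub_le_sub_right hθ.2 (1/2))
          gcongr
      _ = C2 * u ^ (1/2 : ℝ) := by
          rw [mul_left_comm, ← Real.rpow_add hu]; ring_nf
      _ ≤ _ := by nlinarith [mul_nonneg hC2 p1.le, mul_nonneg hC1 p1.le, mul_nonneg hC1 p2.le]

theorem int_small : IntegrableOn (fun u : ℝ => u ^ (-(1/2) : ℝ)) (Ioc 0 1) := by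
  have := intervalIntegral.intervalIntegrable_rpow' (a := 0) (b := 1) (r := -(1/2)) (by norm_num)
  rwa [intervalIntegrable_iff_integrableOn_Ioc_of_le (by norm_num)] at this

theorem int_large : IntegrableOn (fun u : ℝ => u ^ (-3 : ℝ)) (Ioi 1) :=
  integrableOn_Ioi_rpow_of_lt (by norm_num) (by norm_num)

theorem wt_le_one (u : ℝ) : wt u ≤ 1 := by
  unfold wt
  apply inv_le_one_of_one_le₀
  nlinarith [sq_nonneg u]

theorem wt_le_rpow (u : ℝ) (hu : 0 < u) : wt u ≤ u ^ (-4 : ℝ) := by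
  unfold wt
  rw [Real.rpow_neg hu.le]
  apply inv_anti₀ (by positivity)
  rw [show (4:ℝ) = (4:ℕ) by norm_num, Real.rpow_natCast]
  nlinarith [sq_nonneg u]

theorem int_W : IntegrableOn (fun u : ℝ => (u ^ (-(1/2) : ℝ) + u ^ (1/2 : ℝ)) * wt u) (Ioi 0) := by
  have hm : Measurable (fun u : ℝ => (u ^ (-(1/2) : ℝ) + u ^ (1/2 : ℝ)) * wt u) := by
    unfold wt; fun_prop
  rw [← Ioc_union_Ioi_eq_Ioi (zero_le_one' ℝ), integrableOn_union]
  constructor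
  · refine Integrable.mono' (int_small.const_mul 2) hm.aestronglyMeasurable ?_
    filter_upwards [ae_restrict_mem measurableSet_Ioc] with u hu
    have p1 : 0 < u ^ (-(1/2) : ℝ) := rpow_pos_of_pos hu.1 _
    have p2 : 0 < u ^ (1/2 : ℝ) := rpow_pos_of_pos hu.1 _
    have h1 : u ^ (1/2 : ℝ) ≤ u ^ (-(1/2) : ℝ) :=
      Real.rpow_le_rpow_of_exponent_ge hu.1 hu.2 (by norm_num)
    have := wt_pos u
    rw [Real.norm_eq_abs, abs_of_pos (by positivity)]
    nlinarith [wt_le_one u]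
  · refine Integrable.mono' (int_large.const_mul 2) hm.aestronglyMeasurable ?_
    filter_upwards [ae_restrict_mem measurableSet_Ioi] with u hu
    have hu1 : 1 < u := hu
    have hu0 : 0 < u := by linarith
    have p1 : 0 < u ^ (-(1/2) : ℝ) := rpow_pos_of_pos hu0 _
    have p2 : 0 < u ^ (1/2 : ℝ) := rpow_pos_of_pos hu0 _
    have p3 : 0 < u ^ (1 : ℝ) := rpow_pos_of_pos hu0 _
    have h1 : u ^ (-(1/2) : ℝ) ≤ u ^ (1 : ℝ) :=
      Real.rpow_le_rpow_of_exponent_le hu1.le (by norm_num)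
    have h2 : u ^ (1/2 : ℝ) ≤ u ^ (1 : ℝ) :=
      Real.rpow_le_rpow_of_exponent_le hu1.le (by norm_num)
    have := wt_pos u
    rw [Real.norm_eq_abs, abs_of_pos (by positivity)]
    calc _ ≤ (u ^ (1:ℝ) + u^(1:ℝ)) * u ^ (-4 : ℝ) := by
          gcongr
          exact wt_le_rpow u hu0
      _ = 2 * u ^ (-3 : ℝ) := by
          rw [← two_mul, mul_assoc, ← Real.rpow_add hu0]; norm_num

def Kr (s : ℝ) (n : ℕ) (f : 𝓢(ℝ, ℝ)) (y u : ℝ) : ℝ := u ^ s * log u ^ n * f (y - u)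

def Gf (f : 𝓢(ℝ, ℝ)) (n : ℕ) (y θ : ℝ) : ℝ := ∫ u in Ioi (0:ℝ), Kr (θ - 1/2) n f y u

theorem Kr_meas (s : ℝ) (n : ℕ) (f : 𝓢(ℝ, ℝ)) (y : ℝ) : Measurable (Kr s n f y) := by
  have : Measurable f := f.continuous.measurable
  unfold Kr; fun_prop

theorem Kr_bound (a b : ℝ) (ha : 0 < a) (hb : b < 1) (n : ℕ) (f : 𝓢(ℝ, ℝ)) (z : ℝ) :
    ∃ C : ℝ, ∀ θ ∈ Icc a b, ∀ y, |y| ≤ z → ∀ u, 0 < u →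
      ‖Kr (θ - 1/2) n f y u‖ ≤ C * ((u ^ (-(1/2) : ℝ) + u ^ (1/2 : ℝ)) * wt u) := by
  obtain ⟨C1, hC1, h1⟩ := ker_bound a b ha hb n
  obtain ⟨C2, hC2, h2⟩ := schwartz_wt f
  refine ⟨C1 * C2 * (4 * (1 + z^2)^2), fun θ hθ y hy u hu => ?_⟩
  have e1 := h1 θ hθ u hu
  have e2 := h2 (y - u)
  have e3 := wt_sub_le' y u
  have e4 : y^2 ≤ z^2 := by rw [← sq_abs]; gcongr
  have p0 := wt_pos u
  have p1 : 0 < u ^ (-(1/2) : ℝ) := rpow_pos_of_pos hu _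
  have p2 : 0 < u ^ (1/2 : ℝ) := rpow_pos_of_pos hu _
  have p3 : 0 < u ^ (θ - 1/2 : ℝ) := rpow_pos_of_pos hu _
  unfold Kr
  rw [norm_mul, norm_mul, norm_pow, Real.norm_eq_abs, Real.norm_eq_abs, Real.norm_eq_abs,
    abs_of_pos p3]
  calc _ ≤ (C1 * (u ^ (-(1/2) : ℝ) + u ^ (1/2 : ℝ))) * (C2 * (4 * (1 + z^2)^2 * wt u)) := by
        gcongr
        refine e2.trans ?_
        gcongr
        refine e3.trans ?_
        gcongr
    _ = _ := by ring

theorem Kr_int (n : ℕ) (f : 𝓢(ℝ, ℝ)) (y θ : ℝ) (h : θ ∈ Ioo (0:ℝ) 1) :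
    IntegrableOn (Kr (θ - 1/2) n f y) (Ioi 0) := by
  obtain ⟨C, hC⟩ := Kr_bound θ θ h.1 h.2 n f |y|
  refine Integrable.mono' (int_W.const_mul C) (Kr_meas _ _ _ _).aestronglyMeasurable ?_
  filter_upwards [ae_restrict_mem measurableSet_Ioi] with u hu
  exact hC θ ⟨le_rfl, le_rfl⟩ y le_rfl u hu

theorem Gf_deriv_y (f : 𝓢(ℝ, ℝ)) (n : ℕ) (y θ : ℝ) (h : θ ∈ Ioo (0:ℝ) 1) :
    HasDerivAt (fun t => Gf f n t θ) (Gf (SchwartzMap.derivCLM ℝ ℝ f) n y θ) y := by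
  obtain ⟨C, hC⟩ := Kr_bound θ θ h.1 h.2 n (SchwartzMap.derivCLM ℝ ℝ f) (|y|+1)
  refine (hasDerivAt_integral_of_dominated_loc_of_deriv_le
    (F := fun t u => Kr (θ - 1/2) n f t u)
    (F' := fun t u => Kr (θ - 1/2) n (SchwartzMap.derivCLM ℝ ℝ f) t u)
    (Metric.ball_mem_nhds y one_pos) (Filter.Eventually.of_forall fun t =>
      (Kr_meas _ _ _ _).aestronglyMeasurable) (Kr_int n f y θ h)
    (Kr_meas _ _ _ _).aestronglyMeasurable ?_ (int_W.const_mul C) ?_).2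
  · filter_upwards [ae_restrict_mem measurableSet_Ioi] with u hu t ht
    refine hC θ ⟨le_rfl, le_rfl⟩ t ?_ u hu
    rw [Metric.mem_ball, Real.dist_eq] at ht
    have := abs_sub_abs_le_abs_sub t y
    linarith
  · filter_upwards with u t ht
    unfold Kr
    have h1 : HasDerivAt f (SchwartzMap.derivCLM ℝ ℝ f (t - u)) (t - u) := f.hasDerivAt _
    exact (h1.comp_sub_const t u).const_mul _

theorem Gf_deriv_θ (f : 𝓢(ℝ, ℝ)) (n : ℕ) (y θ : ℝ) (h : θ ∈ Ioo (0:ℝ) 1) :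
    HasDerivAt (fun t => Gf f n y t) (Gf f (n+1) y θ) θ := by
  obtain ⟨C, hC⟩ := Kr_bound (θ/2) ((θ+1)/2) (by linarith [h.1]) (by linarith [h.2]) (n+1) f |y|
  refine (hasDerivAt_integral_of_dominated_loc_of_deriv_le
    (F := fun t u => Kr (t - 1/2) n f y u)
    (F' := fun t u => Kr (t - 1/2) (n+1) f y u)
    (Icc_mem_nhds (a := θ/2) (b := (θ+1)/2) (by linarith [h.1]) (by linarith [h.2]))
      (Filter.Eventually.of_forall fun t =>
      (Kr_meas _ _ _ _).aestronglyMeasurable) (Kr_int n f y θ h)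
    (Kr_meas _ _ _ _).aestronglyMeasurable ?_ (int_W.const_mul C) ?_).2
  · filter_upwards [ae_restrict_mem measurableSet_Ioi] with u hu t ht
    exact hC t ht y le_rfl u hu
  · filter_upwards [ae_restrict_mem measurableSet_Ioi] with u hu t ht
    unfold Kr
    have hu0 : (0:ℝ) < u := hu
    have h1 : HasDerivAt (fun t : ℝ => u ^ (t - 1/2)) (u ^ (t - 1/2) * log u) t := by
      have := ((hasDerivAt_id t).sub_const (1/2)).const_rpow hu0
      simpa [mul_comm] using this
    convert! ((h1.mul_const (log u ^ n)).mul_const (f (y - u))) using 1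
    ring

theorem Psi_eq (f : 𝓢(ℝ, ℝ)) (y θ : ℝ) : PsiFrac (fun x => f x) y θ = Gf f 0 y θ := by
  unfold PsiFrac Gf
  rw [← integral_sub_left_eq_self _ volume y, ← integral_indicator measurableSet_Ioi]
  congr 1
  funext u
  by_cases hu : 0 < u
  · simp [posRPow, Kr, hu]
  · simp [posRPow, hu]

theorem large_bound (n : ℕ) (f : 𝓢(ℝ, ℝ)) :
    ∃ C : ℝ, 0 ≤ C ∧ ∀ s ≤ (1/2 : ℝ), ∀ y u : ℝ, 1 ≤ u →
      ‖Kr s n f y u‖ ≤ C * (1 + y^2)^2 * u ^ (-3 : ℝ) := by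
  obtain ⟨C1, hC1, h1⟩ := log_large (1/2) (by norm_num) n
  obtain ⟨C2, hC2, h2⟩ := schwartz_wt f
  refine ⟨C1 * C2 * 4, by positivity, fun s hs y u hu => ?_⟩
  have hu0 : 0 < u := by linarith
  have e1 := h1 u hu
  have e2 := h2 (y - u)
  have e3 := wt_sub_le' y u
  have e4 := wt_le_rpow u hu0
  have e5 : u ^ s ≤ u ^ (1/2 : ℝ) := Real.rpow_le_rpow_of_exponent_le hu hs
  have p2 : 0 < u ^ (1/2 : ℝ) := rpow_pos_of_pos hu0 _
  have p3 : 0 < u ^ s := rpow_pos_of_pos hu0 _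
  unfold Kr
  rw [norm_mul, norm_mul, norm_pow, Real.norm_eq_abs, Real.norm_eq_abs, Real.norm_eq_abs,
    abs_of_pos p3]
  calc _ ≤ (u ^ (1/2 : ℝ) * (C1 * u ^ (1/2 : ℝ))) * (C2 * (4 * (1 + y^2)^2 * u ^ (-4 : ℝ))) := by
        gcongr
        refine e2.trans ?_
        gcongr
        refine e3.trans ?_
        gcongr
    _ = C1 * C2 * 4 * (1 + y^2)^2 * (u ^ (1/2 : ℝ) * u ^ (1/2 : ℝ) * u ^ (-4 : ℝ)) := by ring
    _ = _ := by
        rw [← Real.rpow_add hu0, ← Real.rpow_add hu0]; norm_num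

theorem large_int (n : ℕ) (f : 𝓢(ℝ, ℝ)) (s : ℝ) (hs : s ≤ 1/2) (y : ℝ) :
    IntegrableOn (Kr s n f y) (Ioi 1) := by
  obtain ⟨C, _, hC⟩ := large_bound n f
  refine Integrable.mono' (int_large.const_mul (C * (1 + y^2)^2))
    (Kr_meas _ _ _ _).aestronglyMeasurable ?_
  filter_upwards [ae_restrict_mem measurableSet_Ioi] with u hu
  exact hC s hs y u (le_of_lt hu)

def If (f : 𝓢(ℝ, ℝ)) (n : ℕ) (s y : ℝ) : ℝ := ∫ u in Ioi (1:ℝ), Kr s n f y u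

theorem If_parts (g : 𝓢(ℝ, ℝ)) (n : ℕ) (s y : ℝ) (hs : s ≤ 1/2) :
    If (SchwartzMap.derivCLM ℝ ℝ g) n s y =
      0 ^ n * g (y - 1) + s * If g n (s-1) y + n * If g (n-1) (s-1) y := by
  have i1 := large_int n g (s-1) (by linarith) y
  have i2 := large_int (n-1) g (s-1) (by linarith) y
  have i3 := large_int n (SchwartzMap.derivCLM ℝ ℝ g) s hs y
  obtain ⟨C, hC0, hC⟩ := large_bound n g
  have key := integral_Ioi_of_hasDerivAt_of_tendsto' (a := 1) (m := 0)
    (f := fun u => Kr s n g y u)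
    (f' := fun u => s * Kr (s-1) n g y u + n * Kr (s-1) (n-1) g y u
      - Kr s n (SchwartzMap.derivCLM ℝ ℝ g) y u) ?_ ?_ ?_
  · rw [integral_sub, integral_add, integral_const_mul, integral_const_mul] at key
    · have e : Kr s n g y 1 = 0 ^ n * g (y - 1) := by simp [Kr]
      rw [e] at key
      unfold If
      linarith
    · exact i1.const_mul s
    · exact i2.const_mul n
    · exact (i1.const_mul s).add (i2.const_mul n)
    · exact i3
  · intro u hu
    have hu0 : 0 < u := lt_of_lt_of_le one_pos hu
    have d1 : HasDerivAt (fun u : ℝ => u ^ s) (s * u ^ (s-1)) u :=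
      Real.hasDerivAt_rpow_const (Or.inl hu0.ne')
    have d2 : HasDerivAt (fun u : ℝ => log u ^ n) (n * log u ^ (n-1) * u⁻¹) u :=
      (Real.hasDerivAt_log hu0.ne').pow n
    have h1 : HasDerivAt g (SchwartzMap.derivCLM ℝ ℝ g (y - u)) (y - u) := g.hasDerivAt _
    have d3 := h1.comp_const_sub y u
    convert! (d1.mul d2).mul d3 using 1
    unfold Kr
    rw [Real.rpow_sub_one hu0.ne']
    simp only [Pi.mul_apply]
    ring
  · exact ((i1.const_mul s).add (i2.const_mul n)).sub i3
  · rw [tendsto_zero_iff_norm_tendsto_zero]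
    have t1 : Filter.Tendsto (fun u : ℝ => C * (1 + y^2)^2 * u ^ (-3 : ℝ)) Filter.atTop (𝓝 0) := by
      have := (tendsto_rpow_neg_atTop (y := 3) (by norm_num)).const_mul (C * (1 + y^2)^2)
      simpa using this
    refine squeeze_zero' (Filter.Eventually.of_forall fun u => norm_nonneg _) ?_ t1
    filter_upwards [Filter.eventually_ge_atTop 1] with u hu
    exact hC s hs y u hu

theorem If_bound (N : ℕ) : ∀ (h : 𝓢(ℝ, ℝ)) (n : ℕ) (M : ℝ), ∃ C : ℝ, 0 ≤ C ∧
    ∀ s, -M ≤ s → s ≤ 1/2 → s ≤ -(15/2) + N → ∀ y,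
      |If ((SchwartzMap.derivCLM ℝ ℝ)^[N] h) n s y| ≤ C * wt y := by
  induction N with
  | zero =>
    intro h n M
    obtain ⟨C1, hC1, h1⟩ := log_large (1/2) (by norm_num) n
    obtain ⟨C2, hC2, h2⟩ := schwartz_wt h
    have hI : 0 ≤ ∫ u in Ioi (1:ℝ), u ^ (-3 : ℝ) :=
      setIntegral_nonneg measurableSet_Ioi fun u hu =>
        (rpow_pos_of_pos (lt_trans one_pos hu) _).le
    refine ⟨C1 * C2 * 16 * ∫ u in Ioi (1:ℝ), u ^ (-3 : ℝ), by positivity, fun s _ _ hs y => ?_⟩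
    have hw := wt_pos y
    calc |If h n s y| ≤ ∫ u in Ioi (1:ℝ), (C1 * C2 * 16 * wt y) * u ^ (-3 : ℝ) := by
          rw [← Real.norm_eq_abs]
          refine norm_integral_le_of_norm_le (int_large.const_mul _) ?_
          filter_upwards [ae_restrict_mem measurableSet_Ioi] with u hu
          have hu1 : 1 ≤ u := le_of_lt hu
          have hu0 : 0 < u := by linarith
          have e1 := h1 u hu1
          have e2 := h2 (y - u)
          have e3 := wt_sub_le y u
          have e5 : u ^ s ≤ u ^ (-(15/2) : ℝ) :=
            Real.rpow_le_rpow_of_exponent_le hu1 (by simpa using hs)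
          have e6 : (1 + u^2)^2 ≤ 4 * u ^ (4:ℝ) := by
            rw [show (4:ℝ) = ((4:ℕ) : ℝ) by norm_num, Real.rpow_natCast]
            have : 1 + u^2 ≤ 2 * u^2 := by nlinarith
            calc (1 + u^2)^2 ≤ (2 * u^2)^2 := by gcongr
              _ = _ := by push_cast; ring
          have p3 : 0 < u ^ s := rpow_pos_of_pos hu0 _
          have p4 : 0 < u ^ (-(15/2) : ℝ) := rpow_pos_of_pos hu0 _
          unfold Kr
          rw [norm_mul, norm_mul, norm_pow, Real.norm_eq_abs, Real.norm_eq_abs, Real.norm_eq_abs,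
            abs_of_pos p3]
          calc _ ≤ (u ^ (-(15/2) : ℝ) * (C1 * u ^ (1/2 : ℝ)))
                  * (C2 * (4 * (4 * u ^ (4:ℝ)) * wt y)) := by
                gcongr
                refine e2.trans ?_
                gcongr
                refine e3.trans ?_
                gcongr
            _ = C1 * C2 * 16 * wt y * (u ^ (-(15/2) : ℝ) * u ^ (1/2 : ℝ) * u ^ (4 : ℝ)) := by ring
            _ = _ := by
                rw [← Real.rpow_add hu0, ← Real.rpow_add hu0]; norm_num
      _ = _ := by rw [integral_const_mul]; ring
  | succ N ih =>
    intro h n M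
    obtain ⟨C1, hC1, h1⟩ := ih h n (M+1)
    obtain ⟨C2, hC2, h2⟩ := ih h (n-1) (M+1)
    obtain ⟨C3, hC3, h3⟩ := schwartz_wt ((SchwartzMap.derivCLM ℝ ℝ)^[N] h)
    refine ⟨C3 * 16 + (|M| + 1/2) * C1 + n * C2, by positivity, fun s hs1 hs2 hs3 y => ?_⟩
    have hw := wt_pos y
    rw [Function.iterate_succ_apply', If_parts _ _ _ _ hs2]
    push_cast at hs3
    have e1 := h1 (s-1) (by linarith) (by linarith) (by linarith) y
    have e2 := h2 (s-1) (by linarith) (by linarith) (by linarith) y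
    have e3 := h3 (y - 1)
    have e4 := wt_sub_le y 1
    have hs : |s| ≤ |M| + 1/2 := by
      rw [abs_le]
      constructor <;> linarith [le_abs_self M, abs_nonneg M]
    have hz : |(0:ℝ)^n| ≤ 1 := by
      rcases n with _ | n <;> simp
    calc _ ≤ |(0:ℝ) ^ n| * |((SchwartzMap.derivCLM ℝ ℝ)^[N] h) (y - 1)|
          + |s| * |If ((SchwartzMap.derivCLM ℝ ℝ)^[N] h) n (s-1) y|
          + n * |If ((SchwartzMap.derivCLM ℝ ℝ)^[N] h) (n-1) (s-1) y| := by
          refine (abs_add_le _ _).trans ?_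
          rw [abs_mul (n:ℝ), Nat.abs_cast]
          gcongr
          refine (abs_add_le _ _).trans ?_
          rw [abs_mul, abs_mul]
      _ ≤ 1 * (C3 * (4 * (1 + 1^2)^2 * wt y)) + (|M| + 1/2) * (C1 * wt y) + n * (C2 * wt y) := by
          gcongr
          refine e3.trans ?_
          gcongr
      _ = _ := by ring

theorem Gf_bound (h : 𝓢(ℝ, ℝ)) (n : ℕ) (a b : ℝ) (ha : 0 < a) (hb : b < 1) :
    ∃ C : ℝ, 0 ≤ C ∧ ∀ y, ∀ θ ∈ Icc a b,
      |Gf ((SchwartzMap.derivCLM ℝ ℝ)^[8] h) n y θ| ≤ C * wt y := by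
  obtain ⟨C1, hC1, h1⟩ := If_bound 8 h n (1/2)
  set f := (SchwartzMap.derivCLM ℝ ℝ)^[8] h
  obtain ⟨C2, hC2, h2⟩ := ker_bound a b ha hb n
  obtain ⟨C3, hC3, h3⟩ := schwartz_wt f
  have hI : 0 ≤ ∫ u in Ioc (0:ℝ) 1, u ^ (-(1/2) : ℝ) :=
    setIntegral_nonneg measurableSet_Ioc fun u hu => (rpow_pos_of_pos hu.1 _).le
  refine ⟨C2 * C3 * 32 * (∫ u in Ioc (0:ℝ) 1, u ^ (-(1/2) : ℝ)) + C1, by positivity,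
    fun y θ hθ => ?_⟩
  have hw := wt_pos y
  have hi := Kr_int n f y θ ⟨by linarith [hθ.1], by linarith [hθ.2]⟩
  have hsplit : Gf f n y θ = (∫ u in Ioc (0:ℝ) 1, Kr (θ - 1/2) n f y u) + If f n (θ - 1/2) y := by
    unfold Gf If
    rw [← Ioc_union_Ioi_eq_Ioi (zero_le_one' ℝ)] at hi ⊢
    rw [integrableOn_union] at hi
    refine setIntegral_union ?_ measurableSet_Ioi hi.1 hi.2
    exact Set.disjoint_left.mpr fun u hu hu' => absurd hu.2 (not_le.mpr hu')
  rw [hsplit]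
  have e1 := h1 (θ - 1/2) (by linarith [hθ.1]) (by linarith [hθ.2])
    (by push_cast; linarith [hθ.2]) y
  have e2 : |∫ u in Ioc (0:ℝ) 1, Kr (θ - 1/2) n f y u| ≤
      ∫ u in Ioc (0:ℝ) 1, (C2 * C3 * 32 * wt y) * u ^ (-(1/2) : ℝ) := by
    rw [← Real.norm_eq_abs]
    refine norm_integral_le_of_norm_le (int_small.const_mul _) ?_
    filter_upwards [ae_restrict_mem measurableSet_Ioc] with u hu
    have k1 := h2 θ hθ u hu.1
    have k2 := h3 (y - u)
    have k3 := wt_sub_le y u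
    have k4 : (1 + u^2)^2 ≤ 4 := by
      have : 1 + u^2 ≤ 2 := by nlinarith [hu.1, hu.2]
      nlinarith [sq_nonneg u]
    have k5 : u ^ (1/2 : ℝ) ≤ u ^ (-(1/2) : ℝ) :=
      Real.rpow_le_rpow_of_exponent_ge hu.1 hu.2 (by norm_num)
    have p1 : 0 < u ^ (-(1/2) : ℝ) := rpow_pos_of_pos hu.1 _
    have p3 : 0 < u ^ (θ - 1/2) := rpow_pos_of_pos hu.1 _
    unfold Kr
    rw [norm_mul, norm_mul, norm_pow, Real.norm_eq_abs, Real.norm_eq_abs, Real.norm_eq_abs,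
      abs_of_pos p3]
    calc _ ≤ (C2 * (u ^ (-(1/2) : ℝ) + u ^ (-(1/2) : ℝ))) * (C3 * (4 * 4 * wt y)) := by
          refine mul_le_mul ?_ ?_ (abs_nonneg _) (by positivity)
          · refine k1.trans ?_
            gcongr
          · refine k2.trans ?_
            gcongr
            refine k3.trans ?_
            gcongr
      _ = _ := by ring
  rw [integral_const_mul] at e2
  refine (abs_add_le _ _).trans ?_
  linarith

def vt (x : ℝ) : ℝ := (1 + x^2)⁻¹

theorem vt_pos (x : ℝ) : 0 < vt x := by unfold vt; positivity

theorem vt_summable : Summable (fun k : ℤ => vt k) := by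
  have h := (Real.summable_one_div_int_add_rpow (1/2) 2).mpr (by norm_num)
  refine Summable.of_nonneg_of_le (fun k => (vt_pos _).le) (fun k => ?_) (h.mul_left 2)
  have hne : (k : ℝ) + 1/2 ≠ 0 := by
    intro h0
    have h1 : (2 * k + 1 : ℝ) = 0 := by linarith
    have h2 : (2 * k + 1 : ℤ) = 0 := by exact_mod_cast h1
    omega
  have hpos : 0 < ((k : ℝ) + 1/2)^2 := by positivity
  rw [show (2:ℝ) = ((2:ℕ):ℝ) by norm_num, Real.rpow_natCast, sq_abs]
  push_cast
  unfold vt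
  rw [mul_one_div, inv_eq_one_div, div_le_div_iff₀ (by positivity) hpos]
  nlinarith [sq_nonneg ((k:ℝ) - 1/2)]

theorem vt_floor (y : ℝ) (k : ℤ) : vt (y - k) ≤ 3 * vt ((k - ⌊y⌋ : ℤ) : ℝ) := by
  unfold vt
  push_cast
  have h1 := Int.floor_le y
  have h2 := Int.lt_floor_add_one y
  rw [← div_eq_mul_inv, le_div_iff₀ (by positivity), inv_mul_le_iff₀ (by positivity)]
  set r := y - ⌊y⌋ with hr
  have e1 : y - k = r - (k - ⌊y⌋) := by rw [hr]; ring
  rw [e1]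
  set l := (k:ℝ) - ⌊y⌋
  have r0 : 0 ≤ r := by linarith
  have r1 : r ≤ 1 := by linarith
  nlinarith [sq_nonneg (2 * l - 3 * r), sq_nonneg (l - 2 * r)]

theorem vt_sum : ∃ B : ℝ, 0 ≤ B ∧ ∀ y : ℝ, Summable (fun k : ℤ => vt (y - k)) ∧
    ∑' k : ℤ, vt (y - k) ≤ B := by
  refine ⟨3 * ∑' k : ℤ, vt k, mul_nonneg (by norm_num) (tsum_nonneg fun k => (vt_pos _).le),
    fun y => ?_⟩
  have hs : Summable (fun k : ℤ => 3 * vt ((k - ⌊y⌋ : ℤ) : ℝ)) :=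
    ((Equiv.subRight ⌊y⌋).summable_iff.mpr vt_summable).mul_left 3
  have h1 : Summable (fun k : ℤ => vt (y - k)) :=
    Summable.of_nonneg_of_le (fun k => (vt_pos _).le) (vt_floor y) hs
  refine ⟨h1, (h1.tsum_le_tsum (vt_floor y) hs).trans ?_⟩
  rw [tsum_mul_left]
  exact (congrArg (3 * ·) ((Equiv.subRight ⌊y⌋).tsum_eq (fun k : ℤ => vt k))).le

theorem vt_unif (y z : ℝ) (hy : |y| ≤ z) (k : ℤ) : vt (y - k) ≤ (2 + 2 * z^2) * vt k := by
  have : y^2 ≤ z^2 := by rw [← sq_abs]; gcongr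
  unfold vt
  rw [← div_eq_mul_inv, le_div_iff₀ (by positivity), inv_mul_le_iff₀ (by positivity)]
  nlinarith [sq_nonneg ((k:ℝ) - 2 * y), mul_nonneg (sq_nonneg z) (sq_nonneg (y - k))]

theorem log_wt (y z : ℝ) (hz : 0 ≤ z) (hy : |y| ≤ z) (k : ℤ) :
    Real.sqrt (Real.log (2 + |(k:ℝ)|)) * wt (y - k)
      ≤ 4 * Real.sqrt (Real.log (2 + z)) * vt (y - k) := by
  set w := |y - k| with hw
  have w0 : 0 ≤ w := abs_nonneg _
  have hk : |(k:ℝ)| ≤ z + w := by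
    have := abs_sub_abs_le_abs_sub (k:ℝ) y
    rw [abs_sub_comm] at this
    linarith
  have hl2 : (1/2 : ℝ) ≤ Real.log (2 + z) := by
    have h1 : Real.log 2 ≤ Real.log (2 + z) := Real.log_le_log (by norm_num) (by linarith)
    linarith [Real.log_two_gt_d9]
  have h1 : Real.log (2 + |(k:ℝ)|) ≤ Real.log (2+z) * (3 + 2 * w) := by
    calc Real.log (2 + |(k:ℝ)|) ≤ Real.log ((2 + z) * (2 + w)) := by
          apply Real.log_le_log (by positivity)
          nlinarith [mul_nonneg hz w0]
      _ = Real.log (2 + z) + Real.log (2 + w) := Real.log_mul (by positivity) (by positivity)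
      _ ≤ Real.log (2 + z) + (1 + w) := by
          have := Real.log_le_sub_one_of_pos (show 0 < 2 + w by positivity)
          linarith
      _ ≤ _ := by nlinarith
  have h2 : Real.sqrt (Real.log (2 + |(k:ℝ)|)) ≤ Real.sqrt (Real.log (2 + z)) * (3 + 2 * w) := by
    calc _ ≤ Real.sqrt (Real.log (2+z) * (3 + 2 * w)) := Real.sqrt_le_sqrt h1
      _ = Real.sqrt (Real.log (2 + z)) * Real.sqrt (3 + 2 * w) := Real.sqrt_mul (by linarith) _
      _ ≤ _ := by
          gcongr
          rw [Real.sqrt_le_left (by positivity)]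
          nlinarith
  have h3 : (3 + 2 * w) * wt (y - k) ≤ 4 * vt (y - k) := by
    unfold wt vt
    rw [← sq_abs (y - k), ← hw, ← div_eq_mul_inv, ← div_eq_mul_inv,
      div_le_div_iff₀ (by positivity) (by positivity)]
    have : 3 + 2 * w ≤ 4 * (1 + w^2) := by nlinarith [sq_nonneg (w - 1/4)]
    nlinarith [sq_nonneg w]
  calc _ ≤ Real.sqrt (Real.log (2 + z)) * (3 + 2 * w) * wt (y - k) := by
        gcongr
        exact (wt_pos _).le
    _ = Real.sqrt (Real.log (2 + z)) * ((3 + 2 * w) * wt (y - k)) := by ring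
    _ ≤ Real.sqrt (Real.log (2 + z)) * (4 * vt (y - k)) := by gcongr
    _ = _ := by ring

section sums

variable (φ : 𝓢(ℝ, ℝ)) (e : ℤ × ℤ → ℝ) (C₀ : ℝ)

def fm (m : ℕ) : 𝓢(ℝ, ℝ) := (SchwartzMap.derivCLM ℝ ℝ)^[8] ((SchwartzMap.derivCLM ℝ ℝ)^[m] φ)

theorem fm_succ (m : ℕ) : SchwartzMap.derivCLM ℝ ℝ (fm φ m) = fm φ (m+1) := by
  unfold fm
  rw [← Function.iterate_add_apply, ← Function.iterate_add_apply]
  exact (Function.iterate_succ_apply' _ _ _).symm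

/-- bound for the terms -/
theorem term_bound
    (hbd : ∀ j k : ℤ, |e (j, k)|
      ≤ C₀ * Real.sqrt (Real.log (2 + |(j : ℝ)|) * Real.log (2 + |(k : ℝ)|)))
    (m n : ℕ) (a b : ℝ) (ha : 0 < a) (hb : b < 1) :
    ∃ C : ℝ, 0 ≤ C ∧ ∀ j : ℤ, ∀ z : ℝ, 0 ≤ z → ∀ y, |y| ≤ z → ∀ θ ∈ Icc a b, ∀ k : ℤ,
      |e (j, k)| * |Gf (fm φ m) n (y - k) θ|
        ≤ C * Real.sqrt (Real.log (2 + z) * Real.log (2 + |(j : ℝ)|)) * vt (y - k) := by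
  obtain ⟨C, hC, h⟩ := Gf_bound ((SchwartzMap.derivCLM ℝ ℝ)^[m] φ) n a b ha hb
  have hC₀ : 0 ≤ C₀ := by
    have h0 := (abs_nonneg _).trans (hbd 0 0)
    have h1 : 0 < Real.sqrt (Real.log (2 + |((0:ℤ) : ℝ)|) * Real.log (2 + |((0:ℤ) : ℝ)|)) := by
      have : 0 < Real.log 2 := Real.log_pos (by norm_num)
      apply Real.sqrt_pos.mpr
      simp only [Int.cast_zero, abs_zero, add_zero]
      positivity
    exact nonneg_of_mul_nonneg_left h0 h1
  refine ⟨4 * C₀ * C, by positivity, fun j z hz y hy θ hθ k => ?_⟩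
  have e1 := hbd j k
  have e2 : |Gf (fm φ m) n (y - k) θ| ≤ C * wt (y - k) := h (y - k) θ hθ
  have e3 := log_wt y z hz hy k
  have hj : 0 ≤ Real.log (2 + |(j:ℝ)|) := Real.log_nonneg (by linarith [abs_nonneg (j:ℝ)])
  have hz' : 0 ≤ Real.log (2 + z) := Real.log_nonneg (by linarith)
  rw [Real.sqrt_mul hj] at e1
  rw [Real.sqrt_mul hz']
  calc _ ≤ (C₀ * (Real.sqrt (Real.log (2 + |(j:ℝ)|)) * Real.sqrt (Real.log (2 + |(k:ℝ)|))))
          * (C * wt (y - k)) := by gcongr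
    _ = C₀ * C * Real.sqrt (Real.log (2 + |(j:ℝ)|)) *
          (Real.sqrt (Real.log (2 + |(k:ℝ)|)) * wt (y - k)) := by ring
    _ ≤ C₀ * C * Real.sqrt (Real.log (2 + |(j:ℝ)|)) *
          (4 * Real.sqrt (Real.log (2 + z)) * vt (y - k)) := by gcongr
    _ = _ := by ring

def Tf (j : ℤ) (m n : ℕ) (y θ : ℝ) : ℝ := ∑' k : ℤ, e (j, k) * Gf (fm φ m) n (y - k) θ

/-- locally uniform summable bound for the terms -/
theorem term_unif
    (hbd : ∀ j k : ℤ, |e (j, k)|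
      ≤ C₀ * Real.sqrt (Real.log (2 + |(j : ℝ)|) * Real.log (2 + |(k : ℝ)|)))
    (j : ℤ) (m n : ℕ) (z a b : ℝ) (ha : 0 < a) (hb : b < 1) :
    ∃ u : ℤ → ℝ, Summable u ∧ ∀ k : ℤ, ∀ y, |y| ≤ z → ∀ θ ∈ Icc a b,
      ‖e (j, k) * Gf (fm φ m) n (y - k) θ‖ ≤ u k := by
  obtain ⟨C, hC, h⟩ := term_bound φ e C₀ hbd m n a b ha hb
  refine ⟨fun k => C * Real.sqrt (Real.log (2 + z) * Real.log (2 + |(j : ℝ)|))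
    * ((2 + 2 * z^2) * vt k), (vt_summable.mul_left _).mul_left _, fun k y hy θ hθ => ?_⟩
  rw [norm_mul, Real.norm_eq_abs, Real.norm_eq_abs]
  refine (h j z ((abs_nonneg _).trans hy) y hy θ hθ k).trans ?_
  exact mul_le_mul_of_nonneg_left (vt_unif y z hy k) (by positivity)

theorem term_summable
    (hbd : ∀ j k : ℤ, |e (j, k)|
      ≤ C₀ * Real.sqrt (Real.log (2 + |(j : ℝ)|) * Real.log (2 + |(k : ℝ)|)))
    (j : ℤ) (m n : ℕ) (y θ : ℝ) (h : θ ∈ Ioo (0:ℝ) 1) :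
    Summable (fun k : ℤ => e (j, k) * Gf (fm φ m) n (y - k) θ) := by
  obtain ⟨u, hu, hb⟩ := term_unif φ e C₀ hbd j m n |y| θ θ h.1 h.2
  exact Summable.of_norm_bounded hu fun k => hb k y le_rfl θ ⟨le_rfl, le_rfl⟩

theorem Tf_deriv_y
    (hbd : ∀ j k : ℤ, |e (j, k)|
      ≤ C₀ * Real.sqrt (Real.log (2 + |(j : ℝ)|) * Real.log (2 + |(k : ℝ)|)))
    (j : ℤ) (m n : ℕ) (y θ : ℝ) (h : θ ∈ Ioo (0:ℝ) 1) :
    HasDerivAt (fun t => Tf φ e j m n t θ) (Tf φ e j (m+1) n y θ) y := by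
  obtain ⟨u, hu, hb⟩ := term_unif φ e C₀ hbd j (m+1) n (|y|+1) θ θ h.1 h.2
  have hy : y ∈ Ioo (-(|y|+1)) (|y|+1) :=
    ⟨by linarith [neg_abs_le y], by linarith [le_abs_self y]⟩
  refine hasDerivAt_tsum_of_isPreconnected (g := fun (k : ℤ) t => e (j, k) * Gf (fm φ m) n (t - k) θ)
    (g' := fun (k : ℤ) t => e (j, k) * Gf (fm φ (m+1)) n (t - k) θ)
    hu isOpen_Ioo isPreconnected_Ioo ?_ ?_ hy
    (term_summable φ e C₀ hbd j m n y θ h) hy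
  · intro k t _
    have := Gf_deriv_y (fm φ m) n (t - k) θ h
    rw [fm_succ] at this
    exact (this.comp_sub_const t (k:ℝ)).const_mul _
  · intro k t ht
    exact hb k t (abs_le.mpr ⟨ht.1.le, ht.2.le⟩) θ ⟨le_rfl, le_rfl⟩

theorem Tf_deriv_θ
    (hbd : ∀ j k : ℤ, |e (j, k)|
      ≤ C₀ * Real.sqrt (Real.log (2 + |(j : ℝ)|) * Real.log (2 + |(k : ℝ)|)))
    (j : ℤ) (m n : ℕ) (y θ : ℝ) (h : θ ∈ Ioo (0:ℝ) 1) :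
    HasDerivAt (fun t => Tf φ e j m n y t) (Tf φ e j m (n+1) y θ) θ := by
  obtain ⟨u, hu, hb⟩ := term_unif φ e C₀ hbd j m (n+1) |y| (θ/2) ((θ+1)/2)
    (by linarith [h.1]) (by linarith [h.2])
  have hθ : θ ∈ Ioo (θ/2) ((θ+1)/2) := ⟨by linarith [h.1], by linarith [h.2]⟩
  refine hasDerivAt_tsum_of_isPreconnected (g := fun (k : ℤ) t => e (j, k) * Gf (fm φ m) n (y - k) t)
    (g' := fun (k : ℤ) t => e (j, k) * Gf (fm φ m) (n+1) (y - k) t)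
    hu isOpen_Ioo isPreconnected_Ioo ?_ ?_ hθ
    (term_summable φ e C₀ hbd j m n y θ h) hθ
  · intro k t ht
    exact (Gf_deriv_θ (fm φ m) n (y - k) t
      ⟨by linarith [ht.1, h.1], by linarith [ht.2, h.2]⟩).const_mul _
  · intro k t ht
    exact hb k y le_rfl t ⟨ht.1.le, ht.2.le⟩

theorem Tf_bound
    (hbd : ∀ j k : ℤ, |e (j, k)|
      ≤ C₀ * Real.sqrt (Real.log (2 + |(j : ℝ)|) * Real.log (2 + |(k : ℝ)|)))
    (j : ℤ) (m n : ℕ) (z a b : ℝ) (ha : 0 < a) (hb : b < 1) :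
    ∃ C : ℝ, ∀ y ∈ Icc (-z) z, ∀ θ ∈ Icc a b, |Tf φ e j m n y θ| ≤ C := by
  obtain ⟨u, hu, hb⟩ := term_unif φ e C₀ hbd j m n z a b ha hb
  exact ⟨∑' k, u k, fun y hy θ hθ =>
    tsum_of_norm_bounded hu.hasSum fun k => hb k y (abs_le.mpr hy) θ hθ⟩

end sums

end aux

/-- (i) Each `S_j` is a well-defined `C^∞` function on `ℝ × (0,1)` whose partial
derivatives are obtained termwise; (ii) uniform logarithmic bounds for the sums of
absolute values of the termwise derivatives. -/
theorem Sfun_smooth_and_bounded (ψ : SchwartzMap ℝ ℝ)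
    (hsupp : ∀ ξ : ℝ, (|ξ| < 2 * π / 3 ∨ 8 * π / 3 < |ξ|) → fourierT (fun x => ψ x) ξ = 0)
    (e : ℤ × ℤ → ℝ) (C₀ : ℝ)
    (hbd : ∀ j k : ℤ, |e (j, k)|
      ≤ C₀ * Real.sqrt (Real.log (2 + |(j : ℝ)|) * Real.log (2 + |(k : ℝ)|))) :
    -- (i)
    (∀ j : ℤ,
      (∀ y : ℝ, ∀ θ ∈ Set.Ioo (0:ℝ) 1,
        Summable (fun k : ℤ => e (j, k) * PsiFrac (fun x => ψ x) (y - (k : ℝ)) θ)) ∧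
      ContDiffOn ℝ (⊤ : ℕ∞) (fun p : ℝ × ℝ => Sfun (fun x => ψ x) e j p.1 p.2)
        (Set.univ ×ˢ Set.Ioo (0:ℝ) 1) ∧
      ∀ m n : ℕ, ∀ y : ℝ, ∀ θ ∈ Set.Ioo (0:ℝ) 1,
        pder (Sfun (fun x => ψ x) e j) m n y θ
          = ∑' k : ℤ, e (j, k) * pder (PsiFrac (fun x => ψ x)) m n (y - (k : ℝ)) θ) ∧
    -- (ii)
    (∀ a b : ℝ, 0 < a → a < b → b < 1 → ∀ m n : ℕ, ∃ C : ℝ,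
      ∀ j : ℤ, ∀ z : ℝ, 0 < z → ∀ y ∈ Set.Icc (-z) z, ∀ θ ∈ Set.Icc a b,
        (∑' k : ℤ, |e (j, k)| * |pder (PsiFrac (fun x => ψ x)) m n (y - (k : ℝ)) θ|)
          ≤ C * Real.sqrt (Real.log (2 + z) * Real.log (2 + |(j : ℝ)|))) := by
  obtain ⟨φ, hφ⟩ := exists_primitive ψ hsupp 8
  have hfm : fm φ 0 = ψ := hφ
  have hPsi : ∀ m n y, ∀ θ ∈ Set.Ioo (0:ℝ) 1,
      pder (PsiFrac (fun x => ψ x)) m n y θ = Gf (fm φ m) n y θ := by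
    intro m n y θ hθ
    refine fam_pder (PsiFrac (fun x => ψ x)) (fun m n y θ => Gf (fm φ m) n y θ) ?_ ?_ ?_ m n y θ hθ
    · intro y θ _
      rw [Psi_eq, hfm]
    · intro m n y θ h
      have := Gf_deriv_y (fm φ m) n y θ h
      rwa [fm_succ] at this
    · intro m n y θ h
      exact Gf_deriv_θ (fm φ m) n y θ h
  have hS : ∀ j, Sfun (fun x => ψ x) e j = Tf φ e j 0 0 := by
    intro j
    funext y θ
    unfold Sfun Tf
    rw [hfm]
    simp only [Psi_eq]
  refine ⟨fun j => ⟨?_, ?_, ?_⟩, ?_⟩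
  · intro y θ hθ
    simp only [Psi_eq, ← hfm]
    exact term_summable φ e C₀ hbd j 0 0 y θ hθ
  · rw [hS j]
    rw [contDiffOn_infty]
    intro N
    exact fam_contDiff (Tf φ e j) (Tf_deriv_y φ e C₀ hbd j) (Tf_deriv_θ φ e C₀ hbd j)
      (Tf_bound φ e C₀ hbd j) N 0 0
  · intro m n y θ hθ
    rw [hS j, fam_pder (Tf φ e j 0 0) (Tf φ e j) (fun _ _ _ => rfl) (Tf_deriv_y φ e C₀ hbd j)
      (Tf_deriv_θ φ e C₀ hbd j) m n y θ hθ]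
    unfold Tf
    simp only [hPsi m n _ θ hθ]
  · intro a b ha hab hb m n
    obtain ⟨C, hC, h⟩ := term_bound φ e C₀ hbd m n a b ha hb
    obtain ⟨B, hB, hv⟩ := vt_sum
    refine ⟨C * B, fun j z hz y hy θ hθ => ?_⟩
    have hθ' : θ ∈ Set.Ioo (0:ℝ) 1 := ⟨by linarith [hθ.1], by linarith [hθ.2]⟩
    simp only [hPsi m n _ θ hθ']
    have hs := ((hv y).1.mul_left (C * Real.sqrt (Real.log (2 + z) * Real.log (2 + |(j : ℝ)|))))
    have ht := h j z hz.le y (abs_le.mpr hy) θ hθ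
    have hs' := Summable.of_nonneg_of_le (fun k => by positivity) ht hs
    refine (hs'.tsum_le_tsum ht hs).trans ?_
    rw [tsum_mul_left]
    calc _ ≤ C * Real.sqrt (Real.log (2 + z) * Real.log (2 + |(j : ℝ)|)) * B := by
          gcongr
          exact (hv y).2
      _ = _ := by ring

end
end

section
/- Let ψ : ℝ → ℝ be a real-valued Schwartz function whose Fourier transform ψ̂(ξ) = ∫_ℝ e^{−iξx} ψ(x) dx vanishes outside { ξ : 2π/3 ≤ |ξ| ≤ 8π/3 }, let Ψ(y,θ) = ∫_ℝ (y−x)₊^{θ−1/2} ψ(x) dx, and let (ε_{j,k})_{(j,k)∈ℤ²} be real numbers with |ε_{j,k}| ≤ C₀ √( log(2+|j|) log(2+|k|) ) for some C₀ < ∞. Define B̃₂(t,θ) = Σ_{j=1}^{∞} 2^{−jθ} Σ_{k∈ℤ} ε_{j,k} Ψ(2^j t − k, θ). Then: (i) B̃₂ is a well-defined continuous function on ℝ × (0,1); (ii) for each fixed t ∈ ℝ, θ ↦ B̃₂(t,θ) is C^∞ on (0,1); and (iii) for every nonnegative integer n, the function (t,θ) ↦ ∂_θⁿ B̃₂(t,θ)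 is continuous on ℝ × (0,1). -/
open MeasureTheory Set Real

noncomputable section

/-- The high-frequency part
`B̃₂(t,θ) = Σ_{j=1}^∞ 2^{−jθ} Σ_{k∈ℤ} ε_{j,k} Ψ(2^j t − k, θ)`. -/
def Btwo (ψ : ℝ → ℝ) (e : ℤ × ℤ → ℝ) (t θ : ℝ) : ℝ :=
  ∑' j : ℕ, (2:ℝ) ^ (-((j : ℝ) + 1) * θ)
    * ∑' k : ℤ, e ((j : ℤ) + 1, k) * PsiFrac ψ ((2:ℝ) ^ ((j : ℤ) + 1) * t - (k : ℝ)) θ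


/-- Jointly continuous on `ℝ × U` and holomorphic in the second variable on `U`. -/
structure GoodFun (F : ℝ → ℂ → ℂ) (U : Set ℂ) : Prop where
  cont : ContinuousOn (fun p : ℝ × ℂ => F p.1 p.2) (univ ×ˢ U)
  diff : ∀ t, DifferentiableOn ℂ (F t) U

open Topology Filter in
lemma GoodFun.deriv {F : ℝ → ℂ → ℂ} {U : Set ℂ} (hU : IsOpen U) (h : GoodFun F U) :
    GoodFun (fun t => deriv (F t)) U := by
  refine ⟨?_, fun t => (h.diff t).deriv hU⟩
  have hUn : IsOpen ((univ : Set ℝ) ×ˢ U) := isOpen_univ.prod hU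
  rintro ⟨t₀, z₀⟩ ⟨-, hz₀⟩
  have hL : TendstoLocallyUniformlyOn F (F t₀) (𝓝 t₀) U := by
    rw [Metric.tendstoLocallyUniformlyOn_iff]
    intro ε hε x hx
    have hc : ContinuousAt (fun p : ℝ × ℂ => F p.1 p.2) (t₀, x) :=
      h.cont.continuousAt (hUn.mem_nhds ⟨trivial, hx⟩)
    have := Metric.tendsto_nhds.1 hc (ε / 2) (by positivity)
    rw [nhds_prod_eq, eventually_prod_iff] at this
    obtain ⟨p, hp, q, hq, H⟩ := this
    refine ⟨{y | q y}, mem_nhdsWithin_of_mem_nhds hq, ?_⟩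
    filter_upwards [hp] with t ht y hy
    have h1 := H ht hy
    have h2 := H hp.self_of_nhds hy
    have := dist_triangle_right (F t₀ y) (F t y) (F t₀ x)
    simp only at h1 h2
    linarith
  have hD : TendstoLocallyUniformlyOn (fun t => _root_.deriv (F t)) (_root_.deriv (F t₀)) (𝓝 t₀) U :=
    hL.deriv (Eventually.of_forall h.diff) hU
  have hcd : ContinuousAt (_root_.deriv (F t₀)) z₀ :=
    ((h.diff t₀).deriv hU).continuousOn.continuousAt (hU.mem_nhds hz₀)
  apply ContinuousAt.continuousWithinAt
  rw [ContinuousAt, Metric.tendsto_nhds]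
  intro ε hε
  obtain ⟨s, hs, H⟩ := Metric.tendstoLocallyUniformlyOn_iff.1 hD (ε / 2) (by positivity) z₀ hz₀
  rw [hU.nhdsWithin_eq hz₀] at hs
  have h3 := Metric.tendsto_nhds.1 hcd (ε / 2) (by positivity)
  rw [nhds_prod_eq]
  filter_upwards [H.prod_mk (inter_mem hs h3)] with p hp
  have h1 := hp.1 p.2 hp.2.1
  have h2 := hp.2.2
  simp only [mem_ofPred_eq] at h2
  have := dist_triangle_left (_root_.deriv (F p.1) p.2) (_root_.deriv (F t₀) z₀)
    (_root_.deriv (F t₀) p.2)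
  linarith

open Topology Filter in
lemma GoodFun.tsum {ι : Type*} {F : ι → ℝ → ℂ → ℂ} {U : Set ℂ} (hU : IsOpen U)
    (h : ∀ i, GoodFun (F i) U)
    (hb : ∀ t₀, ∀ z₀ ∈ U, ∃ V ∈ 𝓝 t₀, ∃ W ∈ 𝓝 z₀, ∃ u : ι → ℝ, Summable u ∧
      ∀ i, ∀ t ∈ V, ∀ z ∈ W, ‖F i t z‖ ≤ u i) :
    GoodFun (fun t z => ∑' i, F i t z) U := by
  have hUn : IsOpen ((univ : Set ℝ) ×ˢ U) := isOpen_univ.prod hU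
  refine ⟨?_, ?_⟩
  · rintro ⟨t₀, z₀⟩ ⟨-, hz₀⟩
    obtain ⟨V, hV, W, hW, u, hu, H⟩ := hb t₀ z₀ hz₀
    have : ContinuousOn (fun p : ℝ × ℂ => ∑' i, F i p.1 p.2) (V ×ˢ (W ∩ U)) :=
      continuousOn_tsum (fun i => (h i).cont.mono (fun p hp => ⟨trivial, hp.2.2⟩)) hu
        (fun i p hp => H i _ hp.1 _ hp.2.1)
    exact (this.continuousAt
      (prod_mem_nhds hV (inter_mem hW (hU.mem_nhds hz₀)))).continuousWithinAt
  · intro t z₀ hz₀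
    obtain ⟨V, hV, W, hW, u, hu, H⟩ := hb t z₀ hz₀
    have : DifferentiableOn ℂ (fun z => ∑' i, F i t z) (interior W ∩ U) :=
      Complex.differentiableOn_tsum_of_summable_norm hu
        (fun i => ((h i).diff t).mono inter_subset_right) (isOpen_interior.inter hU)
        (fun i z hz => H i t (mem_of_mem_nhds hV) z (interior_subset hz.1))
    exact (this.differentiableAt (inter_mem (interior_mem_nhds.2 hW)
      (hU.mem_nhds hz₀))).differentiableWithinAt

lemma GoodFun.iter {U : Set ℂ} (hU : IsOpen U) (hUI : ∀ θ ∈ Ioo (0:ℝ) 1, (θ : ℂ) ∈ U) (n : ℕ) :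
    ∀ (F : ℝ → ℂ → ℂ) (f : ℝ → ℝ → ℝ), GoodFun F U →
      (∀ t, ∀ θ ∈ Ioo (0:ℝ) 1, f t θ = (F t θ).re) →
      ContinuousOn (fun p : ℝ × ℝ => iteratedDerivWithin n (f p.1) (Ioo (0:ℝ) 1) p.2)
        (univ ×ˢ Ioo (0:ℝ) 1) := by
  induction n with
  | zero =>
    intro F f hF hf
    simp only [iteratedDerivWithin_zero]
    have : ContinuousOn (fun p : ℝ × ℝ => (F p.1 p.2).re) (univ ×ˢ Ioo (0:ℝ) 1) := by
      apply Complex.continuous_re.comp_continuousOn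
      exact hF.cont.comp (f := fun p : ℝ × ℝ => ((p.1, (p.2 : ℂ)) : ℝ × ℂ))
        (by fun_prop) (fun p hp => ⟨trivial, hUI _ hp.2⟩)
    exact this.congr (fun p hp => hf _ _ hp.2)
  | succ n ih =>
    intro F f hF hf
    simp only [iteratedDerivWithin_succ']
    refine ih (fun t => _root_.deriv (F t)) (fun t => derivWithin (f t) (Ioo 0 1)) (hF.deriv hU) ?_
    intro t θ hθ
    rw [derivWithin_congr (f := fun θ : ℝ => (F t θ).re) (fun θ hθ => hf t θ hθ) (hf t θ hθ)]
    have := ((hF.diff t).differentiableAt (hU.mem_nhds (hUI θ hθ))).hasDerivAt.real_of_complex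
    rw [derivWithin_of_isOpen isOpen_Ioo hθ]
    exact this.deriv

lemma GoodFun.smooth {U : Set ℂ} (hU : IsOpen U) (hUI : ∀ θ ∈ Ioo (0:ℝ) 1, (θ : ℂ) ∈ U)
    (F : ℝ → ℂ → ℂ) (f : ℝ → ℝ → ℝ) (hF : GoodFun F U)
    (hf : ∀ t, ∀ θ ∈ Ioo (0:ℝ) 1, f t θ = (F t θ).re) (t : ℝ) :
    ContDiffOn ℝ (⊤ : ℕ∞) (f t) (Ioo (0:ℝ) 1) := by
  have h1 : ContDiffOn ℂ (⊤ : ℕ∞) (F t) U := (hF.diff t).contDiffOn hU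
  have h2 : ContDiffOn ℝ (⊤ : ℕ∞) (F t) U := h1.restrict_scalars ℝ
  have h3 : ContDiffOn ℝ (⊤ : ℕ∞) (fun θ : ℝ => F t θ) (Ioo (0:ℝ) 1) :=
    h2.comp (f := fun θ : ℝ => (θ : ℂ)) Complex.ofRealCLM.contDiff.contDiffOn hUI
  have h4 : ContDiffOn ℝ (⊤ : ℕ∞) (fun θ : ℝ => (F t θ).re) (Ioo (0:ℝ) 1) :=
    Complex.reCLM.contDiff.comp_contDiffOn h3
  exact h4.congr (fun θ hθ => hf t θ hθ)

/-- Continuous, rapidly decreasing, all moments vanish. -/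
structure VanMom (f : ℝ → ℝ) : Prop where
  cont : Continuous f
  decay : ∀ n : ℕ, ∃ C, ∀ x, (1 + |x|) ^ n * |f x| ≤ C
  mom : ∀ n : ℕ, ∫ x, x ^ n * f x = 0

lemma rapid_integrable {f : ℝ → ℝ} (hc : Continuous f)
    (hd : ∀ n : ℕ, ∃ C, ∀ x, (1 + |x|) ^ n * |f x| ≤ C) (n : ℕ) :
    Integrable (fun x => (1 + |x|) ^ n * |f x|) := by
  obtain ⟨C, hC⟩ := hd (n + 2)
  refine (integrable_inv_one_add_sq.const_mul C).mono'
    (by fun_prop) (Filter.Eventually.of_forall fun x => ?_)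
  have h1 := hC x
  have h0 : 0 ≤ (1 + |x|) ^ n * |f x| := by positivity
  rw [Real.norm_of_nonneg h0, ← div_eq_mul_inv, le_div_iff₀ (by positivity)]
  have : 1 + x ^ 2 ≤ (1 + |x|) ^ 2 := by
    have := abs_nonneg x
    nlinarith [sq_abs x]
  calc _ ≤ (1 + |x|) ^ n * |f x| * (1 + |x|) ^ 2 := by gcongr
    _ = (1 + |x|) ^ (n + 2) * |f x| := by ring
    _ ≤ C := h1

lemma rapid_integrable_pow {f : ℝ → ℝ} (hc : Continuous f)
    (hd : ∀ n : ℕ, ∃ C, ∀ x, (1 + |x|) ^ n * |f x| ≤ C) (n : ℕ) :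
    Integrable (fun x => x ^ n * f x) := by
  refine (rapid_integrable hc hd n).mono' (by fun_prop) (Filter.Eventually.of_forall fun x => ?_)
  rw [norm_mul, norm_pow, Real.norm_eq_abs, Real.norm_eq_abs]
  gcongr
  linarith

lemma rapid_integrable' {f : ℝ → ℝ} (hc : Continuous f)
    (hd : ∀ n : ℕ, ∃ C, ∀ x, (1 + |x|) ^ n * |f x| ≤ C) : Integrable f := by
  simpa using rapid_integrable_pow hc hd 0

lemma VanMom.xmul {f : ℝ → ℝ} (h : VanMom f) : VanMom (fun x => x * f x) := by
  refine ⟨by have := h.cont; fun_prop, fun n => ?_, fun n => ?_⟩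
  · obtain ⟨C, hC⟩ := h.decay (n + 1)
    refine ⟨C, fun x => le_trans ?_ (hC x)⟩
    rw [abs_mul, pow_succ, mul_assoc]
    gcongr
    linarith
  · rw [← h.mom (n + 1)]
    congr 1; ext x; ring

/-- The primitive. -/
def primI (f : ℝ → ℝ) (x : ℝ) : ℝ := ∫ t in Iic x, f t

lemma primI_hasDerivAt {f : ℝ → ℝ} (hc : Continuous f) (hi : Integrable f) (x : ℝ) :
    HasDerivAt (primI f) (f x) x := by
  have : primI f = fun x => (∫ t in (0:ℝ)..x, f t) + primI f 0 := by
    ext x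
    rw [← intervalIntegral.integral_Iic_sub_Iic hi.integrableOn hi.integrableOn]
    simp [primI]
  rw [this]
  exact (hc.integral_hasStrictDerivAt 0 x).hasDerivAt.add_const _

lemma VanMom.prim {f : ℝ → ℝ} (h : VanMom f) : VanMom (primI f) := by
  have hi : Integrable f := rapid_integrable' h.cont h.decay
  have hder := primI_hasDerivAt h.cont hi
  have hc : Continuous (primI f) :=
    continuous_iff_continuousAt.2 fun x => (hder x).continuousAt
  have hset : ∀ n : ℕ, ∀ x : ℝ, ∀ s : Set ℝ, MeasurableSet s → (∀ t ∈ s, |x| ≤ |t|) →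
      (1 + |x|) ^ n * |∫ t in s, f t| ≤ ∫ t, (1 + |t|) ^ n * |f t| := by
    intro n x s hs hst
    calc (1 + |x|) ^ n * |∫ t in s, f t| ≤ (1 + |x|) ^ n * ∫ t in s, |f t| := by
          gcongr; exact abs_integral_le_integral_abs
      _ = ∫ t in s, (1 + |x|) ^ n * |f t| := (integral_const_mul _ _).symm
      _ ≤ ∫ t in s, (1 + |t|) ^ n * |f t| := by
          refine setIntegral_mono_on (hi.abs.const_mul _).integrableOn
            (rapid_integrable h.cont h.decay n).integrableOn hs fun t ht => ?_
          have := hst t ht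
          gcongr
      _ ≤ _ := setIntegral_le_integral (rapid_integrable h.cont h.decay n)
          (Filter.Eventually.of_forall fun t => by positivity)
  have hd : ∀ n : ℕ, ∃ C, ∀ x, (1 + |x|) ^ n * |primI f x| ≤ C := by
    intro n
    refine ⟨∫ t, (1 + |t|) ^ n * |f t|, fun x => ?_⟩
    rcases le_total x 0 with hx | hx
    · refine hset n x _ measurableSet_Iic fun t ht => ?_
      have ht' : t ≤ x := ht
      rw [abs_of_nonpos hx, abs_of_nonpos (by linarith)]
      linarith
    · have h0 : primI f x + ∫ t in Ioi x, f t = 0 := by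
        rw [primI, intervalIntegral.integral_Iic_add_Ioi hi.integrableOn hi.integrableOn]
        simpa using h.mom 0
      have : primI f x = -∫ t in Ioi x, f t := by linarith
      rw [this, abs_neg]
      refine hset n x _ measurableSet_Ioi fun t ht => ?_
      have ht' : x < t := ht
      rw [abs_of_nonneg hx, abs_of_nonneg (by linarith)]
      linarith
  refine ⟨hc, hd, fun n => ?_⟩
  have key := integral_mul_deriv_eq_deriv_mul_of_integrable
    (u := fun x : ℝ => x ^ (n + 1)) (u' := fun x => ((n : ℝ) + 1) * x ^ n)
    (v := primI f) (v' := f)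
    (fun x _ => by simpa using hasDerivAt_pow (n + 1) x) (fun x _ => hder x)
    (rapid_integrable_pow h.cont h.decay (n + 1))
    (by
      have := (rapid_integrable_pow hc hd n).const_mul ((n : ℝ) + 1)
      refine this.congr (Filter.Eventually.of_forall fun x => ?_)
      simp only [Pi.mul_apply]; ring)
    (rapid_integrable_pow hc hd (n + 1))
  rw [h.mom (n + 1)] at key
  simp only [mul_assoc] at key
  rw [integral_const_mul] at key
  have hn : ((n : ℝ) + 1) ≠ 0 := by positivity
  have : ((n : ℝ) + 1) * ∫ x, x ^ n * primI f x = 0 := by linarith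
  exact (mul_eq_zero.1 this).resolve_left hn

open FourierTransform in
lemma schwartz_vanMom (ψ : SchwartzMap ℝ ℝ)
    (hsupp : ∀ ξ : ℝ, (|ξ| < 2 * π / 3 ∨ 8 * π / 3 < |ξ|) → fourierT (fun x => ψ x) ξ = 0) :
    VanMom (fun x => ψ x) := by
  have hd : ∀ n : ℕ, ∃ C, ∀ x, (1 + |x|) ^ n * |ψ x| ≤ C := by
    intro n
    have := fun x => SchwartzMap.one_add_le_sup_seminorm_apply (𝕜 := ℝ) (m := (n, 0)) (k := n)
      (n := 0) le_rfl le_rfl ψ x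
    simp only [norm_iteratedFDeriv_zero] at this
    exact ⟨_, this⟩
  refine ⟨ψ.continuous, hd, fun n => ?_⟩
  set g : ℝ → ℂ := fun x => (ψ x : ℂ) with hg
  have hgi : ∀ n : ℕ, (n : ℕ∞) ≤ ⊤ → Integrable (fun x : ℝ => x ^ n • g x) := by
    intro n _
    have := (rapid_integrable_pow ψ.continuous hd n).ofReal (𝕜 := ℂ)
    refine this.congr (Filter.Eventually.of_forall fun x => ?_)
    simp [hg]
  have hF : ∀ w : ℝ, 𝓕 g w = fourierT (fun x => ψ x) (2 * π * w) := by
    intro w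
    rw [Real.fourier_eq', fourierT]
    congr 1; ext x
    simp only [smul_eq_mul, hg]
    congr 2
    simp
    ring
  have hz : 𝓕 g =ᶠ[nhds 0] fun _ => 0 := by
    filter_upwards [Metric.ball_mem_nhds (0:ℝ) (show (0:ℝ) < 1 / 3 by norm_num)] with w hw
    rw [hF]
    apply hsupp
    left
    rw [Metric.mem_ball, dist_zero_right, Real.norm_eq_abs] at hw
    rw [abs_mul, abs_of_pos Real.two_pi_pos]
    have := Real.pi_pos
    nlinarith
  have h1 := Real.iteratedDeriv_fourier (N := ⊤) (n := n) hgi le_top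
  have h2 : iteratedDeriv n (𝓕 g) 0 = 0 := by
    rw [hz.iteratedDeriv_eq]
    simp
  rw [h1, Real.fourier_eq'] at h2
  simp only [inner_zero_right, mul_zero, Complex.ofReal_zero, zero_mul, Complex.exp_zero,
    one_smul, hg] at h2
  have h3 : (∫ x : ℝ, (-2 * (π:ℂ) * Complex.I * x) ^ n • (ψ x : ℂ))
      = (-2 * (π:ℂ) * Complex.I) ^ n * ((∫ x : ℝ, x ^ n * ψ x : ℝ) : ℂ) := by
    rw [← integral_complex_ofReal, ← integral_const_mul]
    congr 1; ext x
    push_cast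
    rw [mul_pow, smul_eq_mul]; ring
  rw [h3] at h2
  have h4 : (-2 * (π:ℂ) * Complex.I) ^ n ≠ 0 := by
    apply pow_ne_zero
    simp [Real.pi_ne_zero]
  exact_mod_cast (mul_eq_zero.1 h2).resolve_left h4

/-- Complexified fractional primitive. -/
def MM (f : ℝ → ℝ) (y : ℝ) (s : ℂ) : ℂ :=
  ∫ u in Ioi (0:ℝ), (u : ℂ) ^ (s - 1) * (f (y - u) : ℂ)

/-- Dominating function. -/
def gdom (u : ℝ) : ℝ := if u ≤ 1 then u ^ (-(1/2) : ℝ) else u ^ (-2 : ℝ)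

lemma gdom_nonneg {u : ℝ} (hu : 0 < u) : 0 ≤ gdom u := by
  unfold gdom; split_ifs <;> positivity

lemma gdom_integrable : IntegrableOn gdom (Ioi 0) := by
  rw [← Ioc_union_Ioi_eq_Ioi (zero_le_one (α := ℝ))]
  refine IntegrableOn.union ?_ ?_
  · have h : IntegrableOn (fun u : ℝ => u ^ (-(1/2) : ℝ)) (Ioc 0 1) := by
      have := intervalIntegral.intervalIntegrable_rpow' (a := 0) (b := 1) (r := -(1/2))
        (by norm_num)
      rwa [intervalIntegrable_iff_integrableOn_Ioc_of_le zero_le_one] at this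
    refine h.congr_fun (fun u hu => ?_) measurableSet_Ioc
    simp [gdom, hu.2]
  · have h : IntegrableOn (fun u : ℝ => u ^ (-2 : ℝ)) (Ioi 1) :=
      integrableOn_Ioi_rpow_of_lt (by norm_num) one_pos
    refine h.congr_fun (fun u hu => ?_) measurableSet_Ioi
    have : ¬ u ≤ 1 := not_le.2 hu
    simp [gdom, this]

lemma shift_bound {f : ℝ → ℝ} (h : VanMom f) (n : ℕ) : ∃ A, 0 ≤ A ∧ ∀ y u : ℝ, 0 < u →
    (1 + u) ^ n * |f (y - u)| ≤ A * (1 + |y|) ^ n := by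
  obtain ⟨C, hC⟩ := h.decay n
  have hC0 : 0 ≤ C := le_trans (by positivity) (hC 0)
  refine ⟨C, hC0, fun y u hu => ?_⟩
  have h1 : 1 + u ≤ (1 + |y|) * (1 + |y - u|) := by
    have h2 : u ≤ |y| + |y - u| := by
      have := abs_sub_abs_le_abs_sub u y
      rw [abs_sub_comm u y, abs_of_pos hu] at this
      linarith
    nlinarith [abs_nonneg y, abs_nonneg (y - u), mul_nonneg (abs_nonneg y) (abs_nonneg (y - u))]
  calc (1 + u) ^ n * |f (y - u)| ≤ ((1 + |y|) * (1 + |y - u|)) ^ n * |f (y - u)| := by gcongr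
    _ = (1 + |y|) ^ n * ((1 + |y - u|) ^ n * |f (y - u)|) := by rw [mul_pow]; ring
    _ ≤ (1 + |y|) ^ n * C := by gcongr; exact hC _
    _ = _ := mul_comm _ _

lemma dom_bound {f : ℝ → ℝ} (h : VanMom f) : ∃ A, 0 ≤ A ∧ ∀ (y u : ℝ) (s : ℂ), 0 < u →
    1/2 ≤ s.re → s.re ≤ 3 → ‖(u : ℂ) ^ (s - 1) * (f (y - u) : ℂ)‖ ≤ A * (1 + |y|) ^ 4 * gdom u := by
  obtain ⟨A, hA, H⟩ := shift_bound h 4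
  refine ⟨A, hA, fun y u s hu h1 h2 => ?_⟩
  rw [norm_mul, Complex.norm_cpow_eq_rpow_re_of_pos hu, Complex.norm_real, Real.norm_eq_abs]
  have hre : (s - 1).re = s.re - 1 := by simp
  rw [hre]
  have H1 := H y u hu
  unfold gdom
  split_ifs with h3
  · have e1 : u ^ (s.re - 1) ≤ u ^ (-(1/2) : ℝ) :=
      Real.rpow_le_rpow_of_exponent_ge hu h3 (by linarith)
    have e2 : |f (y - u)| ≤ A * (1 + |y|) ^ 4 :=
      le_trans (le_mul_of_one_le_left (abs_nonneg _) (one_le_pow₀ (by linarith))) H1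
    calc _ ≤ u ^ (-(1/2) : ℝ) * (A * (1 + |y|) ^ 4) := by gcongr
      _ = _ := mul_comm _ _
  · push Not at h3
    have e1 : u ^ (s.re - 1) ≤ u ^ (2 : ℝ) :=
      Real.rpow_le_rpow_of_exponent_le h3.le (by linarith)
    have e3 : u ^ (-2 : ℝ) = (u ^ 2)⁻¹ := by
      rw [Real.rpow_neg hu.le]; norm_cast
    have e4 : u ^ (2 : ℝ) = u ^ 2 := by norm_cast
    rw [e3, ← div_eq_mul_inv, le_div_iff₀ (by positivity)]
    rw [e4] at e1
    calc _ ≤ u ^ 2 * |f (y - u)| * u ^ 2 := by gcongr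
      _ = u ^ 4 * |f (y - u)| := by ring
      _ ≤ (1 + u) ^ 4 * |f (y - u)| := by gcongr; linarith
      _ ≤ _ := H1

lemma MM_meas {f : ℝ → ℝ} (hc : Continuous f) (y : ℝ) (s : ℂ) :
    AEStronglyMeasurable (fun u : ℝ => (u : ℂ) ^ (s - 1) * (f (y - u) : ℂ))
      (volume.restrict (Ioi 0)) := by
  refine ContinuousOn.aestronglyMeasurable (fun u hu => ?_) measurableSet_Ioi
  apply ContinuousAt.continuousWithinAt
  exact (Complex.continuousAt_ofReal_cpow_const u (s - 1) (Or.inr (ne_of_gt hu))).mul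
    (by fun_prop)

lemma MM_integrable {f : ℝ → ℝ} (h : VanMom f) (y : ℝ) {s : ℂ} (h1 : 1/2 ≤ s.re)
    (h2 : s.re ≤ 3) :
    IntegrableOn (fun u : ℝ => (u : ℂ) ^ (s - 1) * (f (y - u) : ℂ)) (Ioi 0) := by
  obtain ⟨A, hA, H⟩ := dom_bound h
  refine (gdom_integrable.const_mul (A * (1 + |y|) ^ 4)).mono' (MM_meas h.cont y s) ?_
  filter_upwards [ae_restrict_mem measurableSet_Ioi] with u hu
  exact H y u s hu h1 h2

lemma MM_bound0 {f : ℝ → ℝ} (h : VanMom f) : ∃ A, ∀ (y : ℝ) (s : ℂ),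
    1/2 ≤ s.re → s.re ≤ 3 → ‖MM f y s‖ ≤ A * (1 + |y|) ^ 4 := by
  obtain ⟨A, hA, H⟩ := dom_bound h
  refine ⟨A * ∫ u in Ioi 0, gdom u, fun y s h1 h2 => ?_⟩
  have : ‖MM f y s‖ ≤ ∫ u in Ioi 0, A * (1 + |y|) ^ 4 * gdom u := by
    refine norm_integral_le_of_norm_le (gdom_integrable.const_mul _) ?_
    filter_upwards [ae_restrict_mem measurableSet_Ioi] with u hu
    exact H y u s hu h1 h2
  rw [integral_const_mul] at this
  linarith

open Filter Topology in
lemma MM_ibp {f : ℝ → ℝ} (h : VanMom f) (y : ℝ) {s : ℂ} (h1 : 1/2 ≤ s.re)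
    (h2 : s.re ≤ 2) : MM f y (s + 1) = s * MM (primI f) y s := by
  have hp := h.prim
  have hi : Integrable f := rapid_integrable' h.cont h.decay
  have hs0 : s ≠ 0 := by
    rintro rfl
    simp at h1
    linarith
  have i1 := MM_integrable h y (s := s + 1) (by simp; linarith) (by simp; linarith)
  have i2 := MM_integrable hp y (s := s) h1 (by linarith)
  simp only [add_sub_cancel_right] at i1
  have key := integral_Ioi_of_hasDerivAt_of_tendsto (a := (0:ℝ)) (m := (0:ℂ))
    (f := fun u : ℝ => (u : ℂ) ^ s * (primI f (y - u) : ℂ))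
    (f' := fun u : ℝ => s * ((u : ℂ) ^ (s - 1) * (primI f (y - u) : ℂ))
      - (u : ℂ) ^ s * (f (y - u) : ℂ)) ?_ ?_ ?_ ?_
  · rw [integral_sub (i2.const_mul s) i1, integral_const_mul] at key
    simp only [Complex.ofReal_zero, Complex.zero_cpow hs0, zero_mul, sub_zero] at key
    simp only [MM, add_sub_cancel_right]
    exact (sub_eq_zero.1 key).symm
  · apply ContinuousAt.continuousWithinAt
    have hc := hp.cont
    exact (Complex.continuousAt_ofReal_cpow_const 0 s (Or.inl (by linarith))).mul (by fun_prop)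
  · intro u hu
    have hu' : (0:ℝ) < u := hu
    have d1 : HasDerivAt (fun u : ℝ => (u : ℂ) ^ s) (s * (u : ℂ) ^ (s - 1)) u :=
      hasDerivAt_ofReal_cpow_const hu'.ne' hs0
    have d2 : HasDerivAt (fun u : ℝ => primI f (y - u)) (-f (y - u)) u := by
      have := (primI_hasDerivAt h.cont hi (y - u)).comp u ((hasDerivAt_id u).const_sub y)
      rw [mul_neg_one] at this
      exact this
    have := d1.mul d2.ofReal_comp
    convert! this using 1
    push_cast
    ring
  · exact (i2.const_mul s).sub i1
  · obtain ⟨A, hA, H⟩ := dom_bound hp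
    have ht : Tendsto (fun u : ℝ => A * (1 + |y|) ^ 4 * u ^ (-2 : ℝ)) atTop (𝓝 0) := by
      simpa using (tendsto_rpow_neg_atTop (y := 2) (by norm_num)).const_mul (A * (1 + |y|) ^ 4)
    refine squeeze_zero_norm' ?_ ht
    filter_upwards [eventually_gt_atTop 1] with u hu
    have := H y u (s + 1) (by linarith) (by simp; linarith) (by simp; linarith)
    rw [add_sub_cancel_right, gdom, if_neg (not_le.2 hu)] at this
    exact this

lemma MM_rec {f : ℝ → ℝ} (h : VanMom f) (y : ℝ) {s : ℂ} (h1 : 1/2 ≤ s.re)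
    (h2 : s.re ≤ 2) :
    (y : ℂ) * MM f y s = MM (fun x => x * f x) y s + s * MM (primI f) y s := by
  rw [← MM_ibp h y h1 h2]
  have i1 := MM_integrable h y (s := s + 1) (by simp; linarith) (by simp; linarith)
  have i2 := MM_integrable h.xmul y (s := s) h1 (by linarith)
  unfold MM
  rw [← integral_add i2 i1, ← integral_const_mul]
  refine setIntegral_congr_fun measurableSet_Ioi fun u hu => ?_
  have hu0 : (u : ℂ) ≠ 0 := by exact_mod_cast (ne_of_gt hu)
  have : (u : ℂ) ^ (s + 1 - 1) = (u : ℂ) ^ (s - 1) * u := by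
    rw [show s + 1 - 1 = (s - 1) + 1 by ring, Complex.cpow_add _ _ hu0, Complex.cpow_one]
  simp only [this]
  push_cast
  ring

lemma MM_decay (R : ℝ) (m : ℕ) : ∀ f : ℝ → ℝ, VanMom f → ∃ A, ∀ (y : ℝ) (s : ℂ),
    1/2 ≤ s.re → s.re ≤ 2 → ‖s‖ ≤ R → (1 + |y|) ^ m * ‖MM f y s‖ ≤ A * (1 + |y|) ^ 4 := by
  induction m with
  | zero =>
    intro f h
    obtain ⟨A, H⟩ := MM_bound0 h
    exact ⟨A, fun y s h1 h2 _ => by simpa using H y s h1 (by linarith)⟩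
  | succ m ih =>
    intro f h
    obtain ⟨A₁, H₁⟩ := ih f h
    obtain ⟨A₂, H₂⟩ := ih _ h.xmul
    obtain ⟨A₃, H₃⟩ := ih _ h.prim
    refine ⟨A₁ + A₂ + R * A₃, fun y s h1 h2 h3 => ?_⟩
    have hR : 0 ≤ R := (norm_nonneg s).trans h3
    have e : |y| * ‖MM f y s‖ ≤ ‖MM (fun x => x * f x) y s‖ + R * ‖MM (primI f) y s‖ := by
      have : |y| * ‖MM f y s‖ = ‖(y : ℂ) * MM f y s‖ := by
        rw [norm_mul, Complex.norm_real, Real.norm_eq_abs]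
      rw [this, MM_rec h y h1 h2]
      refine (norm_add_le _ _).trans ?_
      rw [norm_mul]
      gcongr
    have p : 0 ≤ (1 + |y|) ^ m := by positivity
    calc (1 + |y|) ^ (m + 1) * ‖MM f y s‖
        = (1 + |y|) ^ m * ‖MM f y s‖ + (1 + |y|) ^ m * (|y| * ‖MM f y s‖) := by ring
      _ ≤ (1 + |y|) ^ m * ‖MM f y s‖ + (1 + |y|) ^ m *
          (‖MM (fun x => x * f x) y s‖ + R * ‖MM (primI f) y s‖) := by gcongr
      _ = (1 + |y|) ^ m * ‖MM f y s‖ + (1 + |y|) ^ m * ‖MM (fun x => x * f x) y s‖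
          + R * ((1 + |y|) ^ m * ‖MM (primI f) y s‖) := by ring
      _ ≤ A₁ * (1 + |y|) ^ 4 + A₂ * (1 + |y|) ^ 4 + R * (A₃ * (1 + |y|) ^ 4) := by
          exact add_le_add (add_le_add (H₁ y s h1 h2 h3) (H₂ y s h1 h2 h3))
            (mul_le_mul_of_nonneg_left (H₃ y s h1 h2 h3) hR)
      _ = _ := by ring

lemma MM_decay3 {f : ℝ → ℝ} (h : VanMom f) (R : ℝ) : ∃ A, 0 ≤ A ∧ ∀ (y : ℝ) (s : ℂ),
    1/2 ≤ s.re → s.re ≤ 2 → ‖s‖ ≤ R → ‖MM f y s‖ ≤ A * ((1 + |y|) ^ 3)⁻¹ := by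
  obtain ⟨A, H⟩ := MM_decay R 7 f h
  refine ⟨max A 0, le_max_right _ _, fun y s h1 h2 h3 => ?_⟩
  have := H y s h1 h2 h3
  rw [← div_eq_mul_inv, le_div_iff₀ (by positivity)]
  have p : 0 < (1 + |y|) ^ 4 := by positivity
  have : ‖MM f y s‖ * (1 + |y|) ^ 3 ≤ A := by
    refine le_of_mul_le_mul_right ?_ p
    calc _ = (1 + |y|) ^ 7 * ‖MM f y s‖ := by ring
      _ ≤ _ := this
  exact this.trans (le_max_left _ _)

open Filter Topology in
lemma MM_diff {f : ℝ → ℝ} (h : VanMom f) (y : ℝ) {s : ℂ} (h1 : 0 < s.re) (h2 : s.re < 2) :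
    DifferentiableAt ℂ (MM f y) s := by
  have e : MM f y = mellin (fun u : ℝ => (f (y - u) : ℂ)) := by
    ext s; simp [MM, mellin]
  rw [e]
  have hc := h.cont
  obtain ⟨A, hA, H⟩ := shift_bound h 4
  refine mellin_differentiableAt_of_isBigO_rpow (a := 4) (b := 0) ?_ ?_ (by linarith) ?_ h1
  · exact (Continuous.locallyIntegrable (by fun_prop)).locallyIntegrableOn _
  · refine Asymptotics.IsBigO.of_bound (A * (1 + |y|) ^ 4) ?_
    filter_upwards [eventually_gt_atTop 0] with u hu
    have e3 : u ^ (-4 : ℝ) = (u ^ 4)⁻¹ := by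
      rw [Real.rpow_neg hu.le]; norm_cast
    rw [e3, Complex.norm_real, Real.norm_eq_abs, Real.norm_of_nonneg (by positivity),
      ← div_eq_mul_inv, le_div_iff₀ (by positivity)]
    calc _ = u ^ 4 * |f (y - u)| := mul_comm _ _
      _ ≤ (1 + u) ^ 4 * |f (y - u)| := by gcongr; linarith
      _ ≤ _ := H y u hu
  · simp only [neg_zero, Real.rpow_zero]
    refine Asymptotics.IsBigO.of_bound (A * (1 + |y|) ^ 4) ?_
    filter_upwards [self_mem_nhdsWithin] with u hu
    have hu' : (0:ℝ) < u := hu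
    rw [Complex.norm_real, Real.norm_eq_abs, norm_one, mul_one]
    exact le_trans (le_mul_of_one_le_left (abs_nonneg _) (one_le_pow₀ (by linarith))) (H y u hu)

open Filter Topology in
lemma MM_cont {f : ℝ → ℝ} (h : VanMom f) (y₀ : ℝ) {s₀ : ℂ} (h1 : 1/2 < s₀.re) (h2 : s₀.re < 2) :
    ContinuousAt (fun p : ℝ × ℂ => MM f p.1 p.2) (y₀, s₀) := by
  obtain ⟨A, hA, H⟩ := dom_bound h
  have hc := h.cont
  have e1 : ∀ᶠ p : ℝ × ℂ in 𝓝 (y₀, s₀), |p.1| < |y₀| + 1 :=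
    (continuous_fst.abs.tendsto (y₀, s₀)).eventually_lt_const (by simp)
  have e2 : ∀ᶠ p : ℝ × ℂ in 𝓝 (y₀, s₀), 1/2 < p.2.re :=
    ((Complex.continuous_re.comp continuous_snd).tendsto (y₀, s₀)).eventually_const_lt h1
  have e3 : ∀ᶠ p : ℝ × ℂ in 𝓝 (y₀, s₀), p.2.re < 2 :=
    ((Complex.continuous_re.comp continuous_snd).tendsto (y₀, s₀)).eventually_lt_const h2
  refine continuousAt_of_dominated
    (bound := fun u => A * (1 + (|y₀| + 1)) ^ 4 * gdom u) ?_ ?_ (gdom_integrable.const_mul _) ?_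
  · exact Eventually.of_forall fun p => MM_meas h.cont p.1 p.2
  · filter_upwards [e1, e2, e3] with p h1 h2 h3
    filter_upwards [ae_restrict_mem measurableSet_Ioi] with u hu
    refine (H p.1 u p.2 hu h2.le (by linarith)).trans ?_
    have := gdom_nonneg hu
    gcongr
  · filter_upwards [ae_restrict_mem measurableSet_Ioi] with u hu
    have hu0 : (u : ℂ) ≠ 0 := by exact_mod_cast (ne_of_gt hu)
    refine ContinuousAt.mul ?_ (by fun_prop)
    refine ContinuousAt.const_cpow (by fun_prop) (Or.inl hu0)

/-- The complex domain. -/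
def UU : Set ℂ := {z | 0 < z.re ∧ z.re < 1 ∧ ‖z‖ < 2}

lemma UU_open : IsOpen UU :=
  (isOpen_lt continuous_const Complex.continuous_re).inter
    ((isOpen_lt Complex.continuous_re continuous_const).inter
      (isOpen_lt continuous_norm continuous_const))

lemma UU_real : ∀ θ ∈ Ioo (0:ℝ) 1, (θ : ℂ) ∈ UU := by
  intro θ hθ
  refine ⟨by simpa using hθ.1, by simpa using hθ.2, ?_⟩
  rw [Complex.norm_real, Real.norm_eq_abs, abs_of_pos hθ.1]
  linarith [hθ.2]

lemma coef_bound {e : ℤ × ℤ → ℝ} {C₀ : ℝ}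
    (hbd : ∀ j k : ℤ, |e (j, k)|
      ≤ C₀ * Real.sqrt (Real.log (2 + |(j : ℝ)|) * Real.log (2 + |(k : ℝ)|))) (j k : ℤ) :
    |e (j, k)| ≤ |C₀| * ((1 + Real.log (2 + |(j : ℝ)|)) * (1 + Real.log (2 + |(k : ℝ)|))) := by
  refine (hbd j k).trans ?_
  have h1 : 0 ≤ Real.log (2 + |(j : ℝ)|) := Real.log_nonneg (by linarith [abs_nonneg (j:ℝ)])
  have h2 : 0 ≤ Real.log (2 + |(k : ℝ)|) := Real.log_nonneg (by linarith [abs_nonneg (k:ℝ)])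
  have h3 := mul_nonneg h1 h2
  have h4 : Real.sqrt (Real.log (2 + |(j : ℝ)|) * Real.log (2 + |(k : ℝ)|))
      ≤ (1 + Real.log (2 + |(j : ℝ)|)) * (1 + Real.log (2 + |(k : ℝ)|)) := by
    rw [Real.sqrt_le_left (by positivity)]
    nlinarith
  calc _ ≤ |C₀| * Real.sqrt (Real.log (2 + |(j : ℝ)|) * Real.log (2 + |(k : ℝ)|)) := by
        gcongr; exact le_abs_self _
    _ ≤ _ := by gcongr

lemma log_shift (x k : ℝ) :
    1 + Real.log (2 + |k|) ≤ (2 + Real.log (2 + |x|)) * (1 + |x - k|) := by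
  have h1 : 2 + |k| ≤ (2 + |x|) * (2 + |x - k|) := by
    have h2 : |k| ≤ |x| + |x - k| := by
      have := abs_sub_abs_le_abs_sub k x
      rw [abs_sub_comm k x] at this
      linarith
    nlinarith [abs_nonneg x, abs_nonneg (x - k), mul_nonneg (abs_nonneg x) (abs_nonneg (x - k))]
  have h2 : Real.log (2 + |k|) ≤ Real.log (2 + |x|) + Real.log (2 + |x - k|) := by
    rw [← Real.log_mul (by positivity) (by positivity)]
    exact Real.log_le_log (by positivity) h1
  have h3 : Real.log (2 + |x - k|) ≤ 1 + |x - k| := by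
    have := Real.log_le_sub_one_of_pos (show 0 < 2 + |x - k| by positivity)
    linarith
  have h4 : 0 ≤ Real.log (2 + |x|) := Real.log_nonneg (by linarith [abs_nonneg x])
  nlinarith [abs_nonneg (x - k), mul_nonneg h4 (abs_nonneg (x - k))]

lemma zsum_base : Summable (fun k : ℤ => ((1 + |(k:ℝ)|) ^ 2)⁻¹) := by
  have : Summable (fun n : ℕ => ((1 + (n:ℝ)) ^ 2)⁻¹) := by
    have := (summable_nat_add_iff 1).2 (Real.summable_nat_pow_inv.2 (show 1 < 2 by norm_num))
    refine this.congr fun n => ?_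
    push_cast
    rw [add_comm]
  refine Summable.of_nat_of_neg ?_ ?_
  · simpa using this
  · simpa using this

lemma peetre (x k : ℝ) : ((1 + |x - k|) ^ 2)⁻¹ ≤ (1 + |x|) ^ 2 * ((1 + |k|) ^ 2)⁻¹ := by
  rw [← div_eq_mul_inv, le_div_iff₀ (by positivity), inv_mul_le_iff₀ (by positivity), ← mul_pow]
  have h2 : |k| ≤ |x| + |x - k| := by
    have := abs_sub_abs_le_abs_sub k x
    rw [abs_sub_comm k x] at this
    linarith
  gcongr
  nlinarith [mul_nonneg (abs_nonneg x) (abs_nonneg (x - k))]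

lemma zsum_summable (x : ℝ) : Summable (fun k : ℤ => ((1 + |x - (k:ℝ)|) ^ 2)⁻¹) :=
  (zsum_base.mul_left ((1 + |x|) ^ 2)).of_nonneg_of_le (fun k => by positivity)
    (fun k => peetre x k)

lemma zsum_le : ∃ S, 0 ≤ S ∧ ∀ x : ℝ, ∑' k : ℤ, ((1 + |x - (k:ℝ)|) ^ 2)⁻¹ ≤ S := by
  refine ⟨∑' k : ℤ, 4 * ((1 + |(k:ℝ)|) ^ 2)⁻¹, tsum_nonneg fun k => by positivity, fun x => ?_⟩
  rw [← (Equiv.addRight ⌊x⌋).tsum_eq (fun k : ℤ => ((1 + |x - (k:ℝ)|) ^ 2)⁻¹)]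
  have e : ∀ k : ℤ, ((1 + |x - ((Equiv.addRight ⌊x⌋ k : ℤ) : ℝ)|) ^ 2)⁻¹
      = ((1 + |Int.fract x - (k:ℝ)|) ^ 2)⁻¹ := by
    intro k
    simp only [Equiv.coe_addRight, Int.cast_add, Int.fract]
    congr 4
    ring
  simp only [e]
  refine Summable.tsum_le_tsum (fun k => ?_) (zsum_summable _) (zsum_base.mul_left 4)
  refine (peetre _ _).trans ?_
  gcongr
  rw [abs_of_nonneg (Int.fract_nonneg x)]
  nlinarith [Int.fract_nonneg x, Int.fract_lt_one x]

/-- Single term of the double series. -/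
def TT (f : ℝ → ℝ) (e : ℤ × ℤ → ℝ) (j : ℕ) (k : ℤ) (t : ℝ) (z : ℂ) : ℂ :=
  (e ((j : ℤ) + 1, k) : ℂ) * MM f ((2:ℝ) ^ ((j : ℤ) + 1) * t - (k : ℝ)) (z + 1/2)

lemma half_re (z : ℂ) : (z + 1/2).re = z.re + 1/2 := by
  simp

lemma TT_good {f : ℝ → ℝ} (h : VanMom f) (e : ℤ × ℤ → ℝ) (j : ℕ) (k : ℤ) :
    GoodFun (TT f e j k) UU := by
  refine ⟨?_, ?_⟩
  · rintro ⟨t, z⟩ ⟨-, hz⟩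
    apply ContinuousAt.continuousWithinAt
    unfold TT
    refine continuousAt_const.mul ?_
    have h1 := MM_cont h ((2:ℝ) ^ ((j : ℤ) + 1) * t - (k : ℝ)) (s₀ := z + 1/2)
      (by rw [half_re]; linarith [hz.1]) (by rw [half_re]; linarith [hz.2.1])
    exact ContinuousAt.comp (f := fun p : ℝ × ℂ =>
      (((2:ℝ) ^ ((j : ℤ) + 1) * p.1 - (k : ℝ), p.2 + 1/2) : ℝ × ℂ)) (x := (t, z)) h1
      (by fun_prop)
  · intro t z hz
    apply DifferentiableAt.differentiableWithinAt
    unfold TT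
    have h1 := MM_diff h ((2:ℝ) ^ ((j : ℤ) + 1) * t - (k : ℝ)) (s := z + 1/2)
      (by rw [half_re]; linarith [hz.1]) (by rw [half_re]; linarith [hz.2.1])
    exact (DifferentiableAt.comp (f := fun z : ℂ => z + 1/2) z h1 (by fun_prop)).const_mul _

lemma TT_bound {f : ℝ → ℝ} (h : VanMom f) {e : ℤ × ℤ → ℝ} {C₀ : ℝ}
    (hbd : ∀ j k : ℤ, |e (j, k)|
      ≤ C₀ * Real.sqrt (Real.log (2 + |(j : ℝ)|) * Real.log (2 + |(k : ℝ)|))) :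
    ∃ B, 0 ≤ B ∧ ∀ (j : ℕ) (T : ℝ), 0 ≤ T → ∀ (k : ℤ) (t : ℝ) (z : ℂ), |t| ≤ T → z ∈ UU →
      ‖TT f e j k t z‖ ≤ B * (1 + T) * ((j:ℝ) + 4) ^ 2 *
        ((1 + |(2:ℝ) ^ ((j : ℤ) + 1) * t - (k:ℝ)|) ^ 2)⁻¹ := by
  obtain ⟨A, hA, H⟩ := MM_decay3 h 3
  refine ⟨|C₀| * A, by positivity, fun j T hT k t z ht hz => ?_⟩
  set x : ℝ := (2:ℝ) ^ ((j : ℤ) + 1) * t with hx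
  have hM := H (x - k) (z + 1/2) (by rw [half_re]; linarith [hz.1])
    (by rw [half_re]; linarith [hz.2.1]) (by
      refine (norm_add_le _ _).trans ?_
      have h2 : ‖(1/2 : ℂ)‖ = 1/2 := by simp
      rw [h2]; linarith [hz.2.2])
  have he := coef_bound hbd ((j:ℤ) + 1) k
  have hj : 1 + Real.log (2 + |(((j:ℤ) + 1 : ℤ) : ℝ)|) ≤ (j:ℝ) + 4 := by
    push_cast
    rw [abs_of_nonneg (by positivity)]
    have := Real.log_le_sub_one_of_pos (show (0:ℝ) < 2 + ((j:ℝ) + 1) by positivity)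
    linarith
  have hxl : 2 + Real.log (2 + |x|) ≤ (1 + T) * ((j:ℝ) + 4) := by
    have e1 : (2:ℝ) ^ ((j : ℤ) + 1) = 2 ^ (j + 1) := by norm_cast
    have e2 : 2 + |x| ≤ 2 ^ (j + 1) * (2 + T) := by
      rw [hx, e1, abs_mul, abs_of_pos (by positivity)]
      have : (1:ℝ) ≤ 2 ^ (j + 1) := one_le_pow₀ (by norm_num)
      nlinarith
    have e3 := Real.log_le_log (by positivity) e2
    rw [Real.log_mul (by positivity) (by positivity), Real.log_pow] at e3
    have e4 := Real.log_le_sub_one_of_pos (show (0:ℝ) < 2 + T by positivity)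
    have e5 : Real.log 2 ≤ 1 := by
      have := Real.log_le_sub_one_of_pos (show (0:ℝ) < 2 by norm_num)
      linarith
    push_cast at e3
    have e6 : ((j:ℝ) + 1) * Real.log 2 ≤ ((j:ℝ) + 1) := by
      have : (0:ℝ) ≤ (j:ℝ) + 1 := by positivity
      nlinarith
    nlinarith [mul_nonneg hT (Nat.cast_nonneg (α := ℝ) j)]
  have hl0 : 0 ≤ Real.log (2 + |x|) := Real.log_nonneg (by linarith [abs_nonneg x])
  have hlj : 0 ≤ Real.log (2 + |(((j:ℤ) + 1 : ℤ) : ℝ)|) :=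
    Real.log_nonneg (by linarith [abs_nonneg (((j:ℤ) + 1 : ℤ) : ℝ)])
  have hlk : 0 ≤ Real.log (2 + |(k : ℝ)|) :=
    Real.log_nonneg (by linarith [abs_nonneg (k : ℝ)])
  have hk := log_shift x k
  unfold TT
  rw [norm_mul, Complex.norm_real, Real.norm_eq_abs]
  calc |e ((j:ℤ) + 1, k)| * ‖MM f (x - k) (z + 1/2)‖
      ≤ (|C₀| * (((j:ℝ) + 4) * (((1 + T) * ((j:ℝ) + 4)) * (1 + |x - k|))))
        * (A * ((1 + |x - k|) ^ 3)⁻¹) := by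
        refine mul_le_mul (he.trans ?_) hM (norm_nonneg _) (by positivity)
        refine mul_le_mul_of_nonneg_left ?_ (abs_nonneg _)
        refine mul_le_mul hj (hk.trans ?_) (by positivity) (by positivity)
        exact mul_le_mul_of_nonneg_right hxl (by positivity)
    _ = _ := by
        have : (1 + |x - k|) ≠ 0 := by positivity
        field_simp

/-- Inner sum. -/
def GG (f : ℝ → ℝ) (e : ℤ × ℤ → ℝ) (j : ℕ) (t : ℝ) (z : ℂ) : ℂ := ∑' k : ℤ, TT f e j k t z

/-- Outer term. -/
def HH (f : ℝ → ℝ) (e : ℤ × ℤ → ℝ) (j : ℕ) (t : ℝ) (z : ℂ) : ℂ :=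
  (2:ℂ) ^ (-((j:ℂ) + 1) * z) * GG f e j t z

lemma TT_summable {f : ℝ → ℝ} (h : VanMom f) {e : ℤ × ℤ → ℝ} {C₀ : ℝ}
    (hbd : ∀ j k : ℤ, |e (j, k)|
      ≤ C₀ * Real.sqrt (Real.log (2 + |(j : ℝ)|) * Real.log (2 + |(k : ℝ)|)))
    (j : ℕ) (t : ℝ) {z : ℂ} (hz : z ∈ UU) :
    Summable (fun k : ℤ => TT f e j k t z) := by
  obtain ⟨B, hB, H⟩ := TT_bound h hbd
  exact Summable.of_norm_bounded ((zsum_summable _).mul_left _)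
    (fun k => H j |t| (abs_nonneg t) k t z le_rfl hz)

lemma GG_good {f : ℝ → ℝ} (h : VanMom f) {e : ℤ × ℤ → ℝ} {C₀ : ℝ}
    (hbd : ∀ j k : ℤ, |e (j, k)|
      ≤ C₀ * Real.sqrt (Real.log (2 + |(j : ℝ)|) * Real.log (2 + |(k : ℝ)|)))
    (j : ℕ) : GoodFun (GG f e j) UU := by
  obtain ⟨B, hB, H⟩ := TT_bound h hbd
  refine GoodFun.tsum UU_open (fun k => TT_good h e j k) fun t₀ z₀ hz₀ => ?_
  set T := |t₀| + 1 with hT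
  have hT0 : 0 ≤ T := by positivity
  refine ⟨{t | |t| < T}, (isOpen_lt continuous_abs continuous_const).mem_nhds
      (show |t₀| < T by linarith), UU, UU_open.mem_nhds hz₀,
    fun k => B * (1 + T) * ((j:ℝ) + 4) ^ 2 *
      ((1 + (2:ℝ) ^ ((j : ℤ) + 1) * T) ^ 2 * ((1 + |(k:ℝ)|) ^ 2)⁻¹),
    (zsum_base.mul_left _).mul_left _, fun k t ht z hz => ?_⟩
  have ht' : |t| < T := ht
  refine (H j T hT0 k t z ht'.le hz).trans ?_
  refine mul_le_mul_of_nonneg_left ((peetre _ _).trans ?_) (by positivity)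
  have : |(2:ℝ) ^ ((j : ℤ) + 1) * t| ≤ (2:ℝ) ^ ((j : ℤ) + 1) * T := by
    rw [abs_mul, abs_of_pos (a := (2:ℝ) ^ ((j : ℤ) + 1)) (by positivity)]
    gcongr
  gcongr

lemma GG_bound {f : ℝ → ℝ} (h : VanMom f) {e : ℤ × ℤ → ℝ} {C₀ : ℝ}
    (hbd : ∀ j k : ℤ, |e (j, k)|
      ≤ C₀ * Real.sqrt (Real.log (2 + |(j : ℝ)|) * Real.log (2 + |(k : ℝ)|)))
    : ∃ B, 0 ≤ B ∧ ∀ (j : ℕ) (T : ℝ), 0 ≤ T → ∀ (t : ℝ) (z : ℂ), |t| ≤ T → z ∈ UU →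
      ‖GG f e j t z‖ ≤ B * (1 + T) * ((j:ℝ) + 4) ^ 2 := by
  obtain ⟨B, hB, H⟩ := TT_bound h hbd
  obtain ⟨S, hS, HS⟩ := zsum_le
  refine ⟨B * S, by positivity, fun j T hT t z ht hz => ?_⟩
  have h1 := tsum_of_norm_bounded ((zsum_summable ((2:ℝ) ^ ((j : ℤ) + 1) * t)).mul_left
    (B * (1 + T) * ((j:ℝ) + 4) ^ 2)).hasSum (fun k => H j T hT k t z ht hz)
  rw [tsum_mul_left] at h1
  refine h1.trans ?_
  calc _ ≤ B * (1 + T) * ((j:ℝ) + 4) ^ 2 * S :=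
        mul_le_mul_of_nonneg_left (HS _) (by positivity)
    _ = _ := by ring

lemma HH_good {f : ℝ → ℝ} (h : VanMom f) {e : ℤ × ℤ → ℝ} {C₀ : ℝ}
    (hbd : ∀ j k : ℤ, |e (j, k)|
      ≤ C₀ * Real.sqrt (Real.log (2 + |(j : ℝ)|) * Real.log (2 + |(k : ℝ)|)))
    (j : ℕ) : GoodFun (HH f e j) UU := by
  have hG := GG_good h hbd j
  have d : Differentiable ℂ (fun z : ℂ => (2:ℂ) ^ (-((j:ℂ) + 1) * z)) := fun z =>
    DifferentiableAt.const_cpow (by fun_prop) (Or.inl two_ne_zero)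
  refine ⟨?_, fun t => d.differentiableOn.mul (hG.diff t)⟩
  exact (d.continuous.comp continuous_snd).continuousOn.mul hG.cont

lemma HH_bound {f : ℝ → ℝ} (h : VanMom f) {e : ℤ × ℤ → ℝ} {C₀ : ℝ}
    (hbd : ∀ j k : ℤ, |e (j, k)|
      ≤ C₀ * Real.sqrt (Real.log (2 + |(j : ℝ)|) * Real.log (2 + |(k : ℝ)|)))
    (T δ : ℝ) (hT : 0 ≤ T) (hδ : 0 < δ) : ∃ u : ℕ → ℝ, Summable u ∧
    ∀ (j : ℕ) (t : ℝ), |t| ≤ T → ∀ z ∈ UU, δ ≤ z.re → ‖HH f e j t z‖ ≤ u j := by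
  obtain ⟨B, hB, H⟩ := GG_bound h hbd
  set r : ℝ := (2:ℝ) ^ (-δ) with hr
  have hr0 : 0 < r := by positivity
  have hr1 : r < 1 := Real.rpow_lt_one_of_one_lt_of_neg (by norm_num) (by linarith)
  have hs : Summable (fun j : ℕ => ((j:ℝ) + 4) ^ 2 * r ^ (j + 4)) := by
    have := (summable_nat_add_iff 4).2 (summable_pow_mul_geometric_of_norm_lt_one 2
      (r := r) (by rwa [Real.norm_of_nonneg hr0.le]))
    refine this.congr fun j => ?_
    push_cast
    rfl
  refine ⟨fun j => B * (1 + T) * (r ^ 3)⁻¹ * (((j:ℝ) + 4) ^ 2 * r ^ (j + 4)), hs.mul_left _,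
    fun j t ht z hz hδz => ?_⟩
  have e1 : ‖(2:ℂ) ^ (-((j:ℂ) + 1) * z)‖ ≤ r ^ (j + 1) := by
    have := Complex.norm_cpow_eq_rpow_re_of_pos (show (0:ℝ) < 2 by norm_num) (-((j:ℂ) + 1) * z)
    have e2 : (-((j:ℂ) + 1) * z).re = -((j:ℝ) + 1) * z.re := by simp
    rw [e2] at this
    push_cast at this
    rw [this, hr, ← Real.rpow_natCast, ← Real.rpow_mul (by norm_num)]
    apply Real.rpow_le_rpow_of_exponent_le (by norm_num)
    push_cast
    have : (0:ℝ) ≤ (j:ℝ) + 1 := by positivity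
    nlinarith
  unfold HH
  rw [norm_mul]
  calc _ ≤ r ^ (j + 1) * (B * (1 + T) * ((j:ℝ) + 4) ^ 2) :=
        mul_le_mul e1 (H j T hT t z ht hz) (norm_nonneg _) (by positivity)
    _ = _ := by
        have : r ^ (j + 4) = r ^ (j + 1) * r ^ 3 := by ring
        beta_reduce
        rw [this]
        field_simp

lemma HH_summable {f : ℝ → ℝ} (h : VanMom f) {e : ℤ × ℤ → ℝ} {C₀ : ℝ}
    (hbd : ∀ j k : ℤ, |e (j, k)|
      ≤ C₀ * Real.sqrt (Real.log (2 + |(j : ℝ)|) * Real.log (2 + |(k : ℝ)|)))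
    (t : ℝ) {z : ℂ} (hz : z ∈ UU) : Summable (fun j : ℕ => HH f e j t z) := by
  obtain ⟨u, hu, H⟩ := HH_bound h hbd |t| z.re (abs_nonneg t) hz.1
  exact Summable.of_norm_bounded hu (fun j => H j t le_rfl z hz le_rfl)

lemma FF_good {f : ℝ → ℝ} (h : VanMom f) {e : ℤ × ℤ → ℝ} {C₀ : ℝ}
    (hbd : ∀ j k : ℤ, |e (j, k)|
      ≤ C₀ * Real.sqrt (Real.log (2 + |(j : ℝ)|) * Real.log (2 + |(k : ℝ)|)))
    : GoodFun (fun t z => ∑' j, HH f e j t z) UU := by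
  refine GoodFun.tsum UU_open (fun j => HH_good h hbd j) fun t₀ z₀ hz₀ => ?_
  have hz0 := hz₀.1
  obtain ⟨u, hu, H⟩ := HH_bound h hbd (|t₀| + 1) (z₀.re / 2) (by positivity) (by linarith)
  refine ⟨{t | |t| < |t₀| + 1}, (isOpen_lt continuous_abs continuous_const).mem_nhds
      (show |t₀| < |t₀| + 1 by linarith), UU ∩ {z | z₀.re / 2 < z.re},
    Filter.inter_mem (UU_open.mem_nhds hz₀)
      ((isOpen_lt continuous_const Complex.continuous_re).mem_nhds
        (show z₀.re / 2 < z₀.re by linarith)), u, hu, fun j t ht z hz => ?_⟩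
  exact H j t (le_of_lt ht) z hz.1 (le_of_lt hz.2)

lemma PsiFrac_eq (f : ℝ → ℝ) (y θ : ℝ) : (PsiFrac f y θ : ℂ) = MM f y ((θ:ℂ) + 1/2) := by
  unfold PsiFrac MM
  rw [← integral_sub_left_eq_self (fun x => posRPow (y - x) (θ - 1/2) * f x) volume y,
    ← integral_complex_ofReal, ← integral_indicator measurableSet_Ioi]
  congr 1; ext u
  rw [sub_sub_cancel]
  by_cases hu : 0 < u
  · rw [indicator_of_mem (show u ∈ Ioi 0 from hu), posRPow, if_pos hu]
    push_cast
    rw [Complex.ofReal_cpow hu.le]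
    congr 2
    push_cast
    ring
  · rw [indicator_of_notMem (show u ∉ Ioi 0 from hu), posRPow, if_neg hu]
    simp

lemma TT_real (f : ℝ → ℝ) (e : ℤ × ℤ → ℝ) (j : ℕ) (k : ℤ) (t θ : ℝ) :
    TT f e j k t θ = ((e ((j : ℤ) + 1, k)
      * PsiFrac f ((2:ℝ) ^ ((j : ℤ) + 1) * t - (k : ℝ)) θ : ℝ) : ℂ) := by
  rw [TT, Complex.ofReal_mul, PsiFrac_eq]

lemma HH_real (f : ℝ → ℝ) (e : ℤ × ℤ → ℝ) (j : ℕ) (t θ : ℝ) :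
    HH f e j t θ = (((2:ℝ) ^ (-((j : ℝ) + 1) * θ)
    * ∑' k : ℤ, e ((j : ℤ) + 1, k) * PsiFrac f ((2:ℝ) ^ ((j : ℤ) + 1) * t - (k : ℝ)) θ : ℝ) : ℂ) := by
  rw [HH, GG, Complex.ofReal_mul, Complex.ofReal_tsum, Complex.ofReal_cpow (by norm_num)]
  simp only [TT_real]
  push_cast
  rfl

/-- (i) `B̃₂` is well-defined and continuous on `ℝ × (0,1)`; (ii) it is `C^∞` in `θ`
for each fixed `t`; (iii) each `θ`-derivative `∂_θⁿB̃₂` is continuous on `ℝ × (0,1)`. -/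
theorem Btwo_regularity (ψ : SchwartzMap ℝ ℝ)
    (hsupp : ∀ ξ : ℝ, (|ξ| < 2 * π / 3 ∨ 8 * π / 3 < |ξ|) → fourierT (fun x => ψ x) ξ = 0)
    (e : ℤ × ℤ → ℝ) (C₀ : ℝ)
    (hbd : ∀ j k : ℤ, |e (j, k)|
      ≤ C₀ * Real.sqrt (Real.log (2 + |(j : ℝ)|) * Real.log (2 + |(k : ℝ)|))) :
    -- (i) well-definedness and continuity
    (∀ t : ℝ, ∀ θ ∈ Set.Ioo (0:ℝ) 1,
      (∀ j : ℕ, Summable (fun k : ℤ =>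
        e ((j : ℤ) + 1, k) * PsiFrac (fun x => ψ x) ((2:ℝ) ^ ((j : ℤ) + 1) * t - (k : ℝ)) θ)) ∧
      Summable (fun j : ℕ => (2:ℝ) ^ (-((j : ℝ) + 1) * θ)
        * ∑' k : ℤ, e ((j : ℤ) + 1, k)
            * PsiFrac (fun x => ψ x) ((2:ℝ) ^ ((j : ℤ) + 1) * t - (k : ℝ)) θ)) ∧
    ContinuousOn (fun p : ℝ × ℝ => Btwo (fun x => ψ x) e p.1 p.2)
      (Set.univ ×ˢ Set.Ioo (0:ℝ) 1) ∧
    -- (ii) smoothness in θ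
    (∀ t : ℝ, ContDiffOn ℝ (⊤ : ℕ∞) (fun θ => Btwo (fun x => ψ x) e t θ) (Set.Ioo (0:ℝ) 1)) ∧
    -- (iii) continuity of the θ-derivatives
    (∀ n : ℕ, ContinuousOn
      (fun p : ℝ × ℝ =>
        iteratedDerivWithin n (fun θ => Btwo (fun x => ψ x) e p.1 θ) (Set.Ioo (0:ℝ) 1) p.2)
      (Set.univ ×ˢ Set.Ioo (0:ℝ) 1)) := by
  have h := schwartz_vanMom ψ hsupp
  have hF := FF_good h hbd
  have hB : ∀ t, ∀ θ ∈ Ioo (0:ℝ) 1, Btwo (fun x => ψ x) e t θ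
      = (∑' j, HH (fun x => ψ x) e j t θ).re := by
    intro t θ _
    simp only [HH_real]
    rw [← Complex.ofReal_tsum, Complex.ofReal_re]
    rfl
  refine ⟨fun t θ hθ => ⟨fun j => ?_, ?_⟩, ?_, ?_, ?_⟩
  · have := TT_summable h hbd j t (UU_real θ hθ)
    simp only [TT_real] at this
    exact Complex.summable_ofReal.1 this
  · have := HH_summable h hbd t (UU_real θ hθ)
    simp only [HH_real] at this
    exact Complex.summable_ofReal.1 this
  · have := GoodFun.iter UU_open UU_real 0 _ (Btwo (fun x => ψ x) e) hF hB
    simpa only [iteratedDerivWithin_zero] using this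
  · exact GoodFun.smooth UU_open UU_real _ (Btwo (fun x => ψ x) e) hF hB
  · intro n
    exact GoodFun.iter UU_open UU_real n _ (Btwo (fun x => ψ x) e) hF hB

end
end
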